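/- Let m ≥ 3 and let a, b, c ∈ ZMod m be nonzero with 2a ≠ 0 and 2b ≠ 0, and suppose gcd(m, a, b, c) = 1 (where the gcd is taken of m together with the canonical integer representatives of a, b, c). Then the generalized rose window graph R(m;a,b,c) is Hamiltonian, i.e., it contains a cycle passing through every vertex exactly once. -/

import Mathlib

open SimpleGraph

/-- The bicirculant graph `B(m;R,S,T)` on vertex set `ZMod m ⊕ ZMod m`:
`u_i = Sum.inl i` are the outer vertices, `v_i = Sum.inr i` the inner vertices;
edges are `u_i u_{i+j}` for `j ∈ R`, `v_i v_{i+j}` for `j ∈ T`, and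
`u_i v_{i+j}` for `j ∈ S`. -/
def bicirculant (m : ℕ) (R S T : Set (ZMod m)) : SimpleGraph (ZMod m ⊕ ZMod m) :=
  SimpleGraph.fromRel (fun x y =>
    match x, y with
    | Sum.inl i, Sum.inl i' => ∃ j ∈ R, i' = i + j
    | Sum.inr i, Sum.inr i' => ∃ j ∈ T, i' = i + j
    | Sum.inl i, Sum.inr i' => ∃ j ∈ S, i' = i + j
    | Sum.inr _, Sum.inl _ => False)

/-- The generalized rose window graph `R(m;a,b,c) = B(m;{a,-a},{0,c},{b,-b})`. -/
def roseWindow (m : ℕ) (a b c : ZMod m) : SimpleGraph (ZMod m ⊕ ZMod m) :=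
  bicirculant m {a, -a} {0, c} {b, -b}

section Lists
variable {W : Type*}

/-- The edges joining consecutive entries of a list. -/
def pathEdges : List W → Set (Sym2 W)
  | [] => ∅
  | [_] => ∅
  | x :: y :: l => insert s(x, y) (pathEdges (y :: l))

/-- The edges joining cyclically consecutive entries of a list. -/
def cycleEdges : List W → Set (Sym2 W)
  | [] => ∅
  | x :: t => pathEdges (x :: t ++ [x])

@[simp] theorem pathEdges_nil : pathEdges ([] : List W) = ∅ := rfl

@[simp] theorem pathEdges_singleton (x : W) : pathEdges [x] = ∅ := rfl

@[simp] theorem pathEdges_cons_cons (x y : W) (l : List W) :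
    pathEdges (x :: y :: l) = insert s(x, y) (pathEdges (y :: l)) := rfl

theorem pathEdges_append (A B : List W) (x : W) :
    pathEdges (A ++ x :: B) = pathEdges (A ++ [x]) ∪ pathEdges (x :: B) := by
  induction A with
  | nil => simp
  | cons y A ih =>
    cases A with
    | nil => ext e; simp
    | cons z A =>
      simp only [List.cons_append, pathEdges_cons_cons] at ih ⊢
      rw [ih, Set.insert_union]

theorem pathEdges_append_cons_cons (A B : List W) (x y : W) :
    pathEdges (A ++ x :: y :: B) =
      insert s(x, y) (pathEdges (A ++ [x]) ∪ pathEdges (y :: B)) := by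
  rw [pathEdges_append, pathEdges_cons_cons, Set.union_insert]

theorem pathEdges_reverse (l : List W) : pathEdges l.reverse = pathEdges l := by
  induction l with
  | nil => rfl
  | cons x l ih =>
    cases l with
    | nil => rfl
    | cons y l =>
      rw [pathEdges_cons_cons, ← ih]
      simp only [List.reverse_cons, List.append_assoc, List.cons_append, List.nil_append]
      rw [pathEdges_append_cons_cons, Sym2.eq_swap]
      simp

theorem cycleEdges_cons (x : W) (t : List W) :
    cycleEdges (x :: t) = pathEdges (x :: t ++ [x]) := rfl

theorem cycleEdges_cons_append (x y : W) (t : List W) :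
    cycleEdges (x :: t ++ [y]) = insert s(x, y) (pathEdges (x :: t ++ [y])) := by
  rw [List.cons_append, cycleEdges_cons]
  have := pathEdges_append_cons_cons (x :: t) [] y x
  simp only [List.cons_append, List.append_assoc, List.nil_append] at this ⊢
  rw [this, Sym2.eq_swap]
  simp

theorem cycleEdges_append_comm (A B : List W) : cycleEdges (A ++ B) = cycleEdges (B ++ A) := by
  cases A with
  | nil => simp
  | cons x A =>
    cases B with
    | nil => simp
    | cons y B =>
      rw [List.cons_append, cycleEdges_cons, List.cons_append (a := y), cycleEdges_cons]
      have h1 := pathEdges_append (x :: A) (B ++ [x]) y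
      have h2 := pathEdges_append (y :: B) (A ++ [y]) x
      simp only [List.cons_append, List.append_assoc] at h1 h2 ⊢
      rw [h1, h2, Set.union_comm]

theorem cycleEdges_reverse (l : List W) : cycleEdges l.reverse = cycleEdges l := by
  cases l with
  | nil => rfl
  | cons x t =>
    rw [List.reverse_cons, cycleEdges_append_comm, cycleEdges_cons, List.singleton_append,
      cycleEdges_cons, ← pathEdges_reverse]
    simp

theorem exists_of_mem_pathEdges {l : List W} {x y : W} (h : s(x, y) ∈ pathEdges l) :
    ∃ A B, l = A ++ x :: y :: B ∨ l = A ++ y :: x :: B := by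
  induction l with
  | nil => simp at h
  | cons z l ih =>
    cases l with
    | nil => simp at h
    | cons w l =>
      rw [pathEdges_cons_cons, Set.mem_insert_iff] at h
      rcases h with h | h
      · rw [Sym2.eq_iff] at h
        rcases h with ⟨rfl, rfl⟩ | ⟨rfl, rfl⟩
        · exact ⟨[], l, Or.inl rfl⟩
        · exact ⟨[], l, Or.inr rfl⟩
      · obtain ⟨A, B, h⟩ := ih h
        refine ⟨z :: A, B, ?_⟩
        simpa using h

theorem exists_perm_of_mem_cycleEdges {l : List W} {x y : W} (hxy : x ≠ y)
    (h : s(x, y) ∈ cycleEdges l) :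
    ∃ t, (x :: t ++ [y]).Perm l ∧ cycleEdges (x :: t ++ [y]) = cycleEdges l := by
  have key : ∀ A B : List W, ∀ x y : W, x ≠ y → ∀ h t, l = h :: t →
      h :: t ++ [h] = A ++ x :: y :: B →
      ∃ t, (x :: t ++ [y]).Perm l ∧ cycleEdges (x :: t ++ [y]) = cycleEdges l := by
    intro A B x y hxy h t hl hA
    rcases List.eq_nil_or_concat B with rfl | ⟨B', z, rfl⟩
    · have h1 : h :: t ++ [h] = (A ++ [x]) ++ [y] := by simpa using hA
      obtain ⟨h2, h3⟩ := List.append_inj' h1 rfl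
      simp only [List.cons.injEq, and_true] at h3
      subst h3
      cases A with
      | nil => simp at h2; exact absurd h2.1.symm hxy
      | cons z A =>
        simp only [List.cons_append, List.cons.injEq] at h2
        obtain ⟨rfl, rfl⟩ := h2
        have e : x :: A.reverse ++ [h] = (h :: (A ++ [x])).reverse := by simp
        rw [hl]
        exact ⟨A.reverse, by rw [e]; exact ⟨List.reverse_perm _, cycleEdges_reverse _⟩⟩
    · have h1 : h :: t ++ [h] = (A ++ x :: y :: B') ++ [z] := by simpa using hA
      obtain ⟨h2, h3⟩ := List.append_inj' h1 rfl
      have e : x :: (B' ++ A).reverse ++ [y] = ((y :: B') ++ (A ++ [x])).reverse := by simp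
      have e' : (A ++ [x]) ++ (y :: B') = l := by rw [hl, h2]; simp
      refine ⟨(B' ++ A).reverse, ?_⟩
      rw [e, cycleEdges_reverse, cycleEdges_append_comm, e']
      refine ⟨(List.reverse_perm _).trans ?_, rfl⟩
      rw [← e']
      exact List.perm_append_comm
  cases l with
  | nil => simp [cycleEdges] at h
  | cons z t =>
    obtain ⟨A, B, hA | hA⟩ := exists_of_mem_pathEdges h
    · exact key A B x y hxy z t rfl hA
    · obtain ⟨t', h1, h2⟩ := key A B y x hxy.symm z t rfl hA
      have e : x :: t'.reverse ++ [y] = (y :: t' ++ [x]).reverse := by simp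
      refine ⟨t'.reverse, ?_⟩
      rw [e, cycleEdges_reverse]
      exact ⟨(List.reverse_perm _).trans h1, h2⟩

theorem mem_of_mem_pathEdges {l : List W} {x y : W} (h : s(x, y) ∈ pathEdges l) : x ∈ l := by
  obtain ⟨A, B, rfl | rfl⟩ := exists_of_mem_pathEdges h <;> simp

theorem mem_of_mem_cycleEdges {l : List W} {x y : W} (h : s(x, y) ∈ cycleEdges l) : x ∈ l := by
  cases l with
  | nil => simp [cycleEdges] at h
  | cons z t =>
    have := mem_of_mem_pathEdges (l := z :: t ++ [z]) h
    simp at this ⊢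
    tauto

/-- Replacing an edge of a cycle by a detour. -/
theorem exists_insert {l : List W} {x y : W} (hxy : x ≠ y) (h : s(x, y) ∈ cycleEdges l)
    (N : List W) :
    ∃ l', l'.Perm (l ++ N) ∧ cycleEdges l' ⊆ cycleEdges l ∪ pathEdges (x :: N ++ [y]) ∧
      cycleEdges l \ {s(x, y)} ⊆ cycleEdges l' ∧ pathEdges (x :: N ++ [y]) ⊆ cycleEdges l' := by
  obtain ⟨t, hp, hc⟩ := exists_perm_of_mem_cycleEdges hxy h
  have e : cycleEdges ((x :: t ++ [y]) ++ N.reverse) =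
      pathEdges (x :: t ++ [y]) ∪ pathEdges (x :: N ++ [y]) := by
    rw [← pathEdges_reverse (x :: N ++ [y])]
    simp only [List.cons_append, List.append_assoc, List.nil_append, List.reverse_cons,
      List.reverse_append, List.reverse_nil, cycleEdges_cons]
    exact pathEdges_append (x :: t) _ y
  refine ⟨(x :: t ++ [y]) ++ N.reverse, hp.append (List.reverse_perm _), ?_⟩
  rw [e, ← hc, cycleEdges_cons_append]
  refine ⟨?_, ?_, Set.subset_union_right⟩
  · exact Set.union_subset_union_left _ (Set.subset_insert _ _)
  · intro e he
    exact Or.inl ((he.1).resolve_left he.2)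

theorem eq_or_eq_of_mem_pathEdges {P Q : List W} {x u z y : W} (hn : (P ++ x :: u :: z :: Q).Nodup)
    (h : s(u, y) ∈ pathEdges (P ++ x :: u :: z :: Q)) : y = x ∨ y = z := by
  rw [pathEdges_append_cons_cons, pathEdges_cons_cons] at h
  have hn' := hn
  simp only [List.nodup_append, List.nodup_cons, List.mem_cons] at hn
  rcases h with h | h | h | h
  · rw [Sym2.eq_iff] at h
    rcases h with ⟨rfl, rfl⟩ | ⟨_, rfl⟩
    · simp at hn
    · exact Or.inl rfl
  · exfalso
    have := mem_of_mem_pathEdges h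
    simp at this
    rcases this with h | h
    · exact hn.2.2 u h u (by simp) rfl
    · subst h
      simp at hn
  · rw [Sym2.eq_iff] at h
    rcases h with ⟨_, rfl⟩ | ⟨rfl, rfl⟩
    · exact Or.inr rfl
    · simp at hn
  · have := mem_of_mem_pathEdges h
    exfalso
    simp at this
    rcases this with h | h
    · subst h; simp at hn
    · simp [h] at hn

/-- Replacing two edges of a cycle by a chord and a detour. -/
theorem exists_two_opt {l : List W} {u₁ u₂ v₂ y₁ y₂ : W} (hl : l.Nodup)
    (h₂ : s(u₂, v₂) ∈ cycleEdges l) (h₁ : s(u₁, y₁) ∈ cycleEdges l)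
    (h₁' : s(u₁, y₂) ∈ cycleEdges l) (hy : y₁ ≠ y₂) (h₁₂ : u₁ ≠ u₂) (hv : u₁ ≠ v₂)
    (h₂₂ : u₂ ≠ v₂) :
    ∃ x, (x = y₁ ∨ x = y₂) ∧ ∀ N : List W, ∃ l', l'.Perm (l ++ N) ∧
      cycleEdges l' ⊆ cycleEdges l ∪ {s(u₁, u₂)} ∪ pathEdges (v₂ :: N ++ [x]) ∧
      cycleEdges l \ {s(u₂, v₂), s(u₁, x)} ⊆ cycleEdges l' ∧
      pathEdges (v₂ :: N ++ [x]) ⊆ cycleEdges l' := by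
  obtain ⟨t, hp, hc⟩ := exists_perm_of_mem_cycleEdges h₂₂ h₂
  have hm : u₁ ∈ t := by
    have := hp.symm.subset (mem_of_mem_cycleEdges h₁)
    simp at this
    tauto
  obtain ⟨A, B, rfl⟩ := List.append_of_mem hm
  obtain ⟨C, x, hC⟩ : ∃ C x, u₂ :: A = C ++ [x] := by
    rcases List.eq_nil_or_concat (u₂ :: A) with h | ⟨C, x, h⟩
    · simp at h
    · exact ⟨C, x, by simpa using h⟩
  obtain ⟨z, D, hD⟩ : ∃ z D, B ++ [v₂] = z :: D := by
    cases B with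
    | nil => exact ⟨_, _, rfl⟩
    | cons z B => exact ⟨_, _, rfl⟩
  have hl' : u₂ :: (A ++ u₁ :: B) ++ [v₂] = C ++ x :: u₁ :: z :: D := by
    rw [← hD, ← List.cons_append, hC]; simp
  have hce : cycleEdges l = insert s(u₂, v₂) (insert s(x, u₁)
      (pathEdges (C ++ [x]) ∪ pathEdges (u₁ :: z :: D))) := by
    rw [← hc, cycleEdges_cons_append, hl', pathEdges_append_cons_cons]
  have hnd : (C ++ x :: u₁ :: z :: D).Nodup := hl' ▸ hp.symm.nodup hl
  have hz : ∀ y, s(u₁, y) ∈ cycleEdges l → y = x ∨ y = z := by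
    intro y hy
    rw [← hc, cycleEdges_cons_append, hl', Set.mem_insert_iff] at hy
    rcases hy with hy | hy
    · rw [Sym2.eq_iff] at hy
      rcases hy with ⟨h, _⟩ | ⟨h, _⟩
      · exact absurd h h₁₂
      · exact absurd h hv
    · exact eq_or_eq_of_mem_pathEdges hnd hy
  refine ⟨x, ?_, fun N => ?_⟩
  · rcases hz _ h₁ with h | h
    · exact Or.inl h.symm
    · rcases hz _ h₁' with h' | h'
      · exact Or.inr h'.symm
      · exact absurd (h.trans h'.symm) hy
  · have hD2 : ∃ E, u₁ :: z :: D = E ++ [v₂] := ⟨u₁ :: B, by rw [← hD]; simp⟩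
    obtain ⟨E, hE⟩ := hD2
    have hCA : ∃ C', (C ++ [x]).reverse = C' ++ [u₂] := ⟨A.reverse, by rw [← hC]; simp⟩
    obtain ⟨C', hC'⟩ := hCA
    have e : cycleEdges ((C ++ [x]).reverse ++ (u₁ :: z :: D) ++ N) =
        insert s(u₁, u₂) (pathEdges (C ++ [x]) ∪ pathEdges (u₁ :: z :: D)
          ∪ pathEdges (v₂ :: N ++ [x])) := by
      have e1 : (C ++ [x]).reverse ++ (u₁ :: z :: D) ++ N =
          x :: (C.reverse ++ (u₁ :: z :: D) ++ N) := by simp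
      have e2 : x :: (C.reverse ++ (u₁ :: z :: D) ++ N) ++ [x] =
          C' ++ u₂ :: u₁ :: (z :: D ++ N ++ [x]) := by
        have : x :: C.reverse = C' ++ [u₂] := by rw [← hC']; simp
        simp only [← List.cons_append]
        rw [this]; simp
      have e3 : u₁ :: (z :: D ++ N ++ [x]) = E ++ v₂ :: (N ++ [x]) := by
        simp only [← List.cons_append]
        rw [hE]; simp
      rw [e1, cycleEdges_cons, e2, pathEdges_append_cons_cons, e3, pathEdges_append E,
        ← hE, ← hC', pathEdges_reverse, Set.union_assoc, Sym2.eq_swap]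
      rfl
    refine ⟨(C ++ [x]).reverse ++ (u₁ :: z :: D) ++ N, ?_, ?_⟩
    · refine List.Perm.append_right _ (List.Perm.trans ?_ hp)
      rw [hl']
      refine (List.Perm.append_right _ (List.reverse_perm _)).trans ?_
      simp
    · rw [e, hce]
      refine ⟨?_, ?_, ?_⟩
      · intro e
        simp only [Set.mem_insert_iff, Set.mem_union, Set.mem_singleton_iff]
        tauto
      · intro e
        rw [Sym2.eq_swap (a := u₁) (b := x)]
        simp only [Set.mem_insert_iff, Set.mem_union, Set.mem_singleton_iff, Set.mem_sdiff]
        tauto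
      · exact fun e he => Or.inr (Or.inr he)

theorem mem_pathEdges_support {G : SimpleGraph W} {u v : W} (p : G.Walk u v) {e : Sym2 W}
    (he : e ∈ p.edges) : e ∈ pathEdges p.support := by
  induction p with
  | nil => simp at he
  | cons h p ih =>
    rw [Walk.edges_cons, List.mem_cons] at he
    rw [Walk.support_cons, ← Walk.cons_tail_support, pathEdges_cons_cons, Walk.cons_tail_support]
    exact he.imp id ih

theorem isChain_of_pathEdges {G : SimpleGraph W} {l : List W} (h : pathEdges l ⊆ G.edgeSet) :
    l.IsChain G.Adj := by
  induction l with
  | nil => simp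
  | cons x l ih =>
    cases l with
    | nil => simp
    | cons y l =>
      rw [pathEdges_cons_cons, Set.insert_subset_iff] at h
      exact List.isChain_cons_cons.2 ⟨h.1, ih h.2⟩

theorem isHamiltonian_of_list [Fintype W] [DecidableEq W] {G : SimpleGraph W} {l : List W}
    (hl : l.Nodup) (hm : ∀ x, x ∈ l) (h3 : 3 ≤ l.length) (he : cycleEdges l ⊆ G.edgeSet) :
    G.IsHamiltonian := by
  intro _
  obtain ⟨x, t, y, rfl⟩ : ∃ x t y, l = x :: t ++ [y] := by
    cases l with
    | nil => simp at h3
    | cons x t =>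
      rcases List.eq_nil_or_concat t with rfl | ⟨t', y, rfl⟩
      · simp at h3
      · exact ⟨x, t', y, by simp⟩
  rw [cycleEdges_cons_append, Set.insert_subset_iff] at he
  have hne : x :: t ++ [y] ≠ [] := by simp
  have hch := isChain_of_pathEdges he.2
  have h1 : (x :: t ++ [y]).head hne = x := by simp
  have h2 : (x :: t ++ [y]).getLast hne = y := by simp
  obtain ⟨p, hp⟩ : ∃ p : G.Walk x y, p.support = x :: t ++ [y] :=
    ⟨(Walk.ofSupport _ hne hch).copy h1 h2, by
      rw [Walk.support_copy, Walk.support_ofSupport]⟩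
  have hxy : G.Adj y x := G.adj_symm he.1
  have hpath : p.IsPath := by
    rw [Walk.isPath_def, hp]; exact hl
  refine ⟨y, Walk.cons hxy p, ?_⟩
  rw [Walk.isHamiltonianCycle_iff_isCycle_and_support_count_tail_eq_one]
  refine ⟨(Walk.cons_isCycle_iff _ _).2 ⟨hpath, fun h => ?_⟩, fun z => ?_⟩
  · have := mem_pathEdges_support p h
    rw [hp] at this
    obtain ⟨A, B, hAB | hAB⟩ := exists_of_mem_pathEdges this
    · cases A with
      | nil =>
        simp at hAB
        exact hxy.ne hAB.1.symm
      | cons z A =>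
        simp only [List.cons_append, List.cons.injEq] at hAB
        have h2 := hl
        rw [List.cons_append, List.nodup_cons, hAB.2] at h2
        simp at h2
    · cases A with
      | nil =>
        simp only [List.cons_append, List.nil_append, List.cons.injEq, true_and] at hAB
        cases t with
        | nil => simp at h3
        | cons z t =>
          simp only [List.cons_append, List.cons.injEq] at hAB
          have h2 := hl
          rw [← hAB.1] at h2
          simp at h2
      | cons z A =>
        simp only [List.cons_append, List.cons.injEq] at hAB
        have h2 := hl
        rw [List.cons_append, List.nodup_cons, hAB.2] at h2
        simp at h2
  · rw [Walk.support_cons, List.tail_cons, hp]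
    exact List.count_eq_one_of_mem hl (hm z)

end Lists

section Rose
variable {W A K : Type*} [AddCommGroup A] [AddCommGroup K]

/-- A graph containing the edges of a rose window graph over the group `A`, together with a
homomorphism whose fibres are the cosets of the group generated by `c`. -/
structure Rose (G : SimpleGraph W) (U V : A → W) (a b c : A) (π : A →+ K) : Prop where
  injU : Function.Injective U
  injV : Function.Injective V
  ne : ∀ z w, U z ≠ V w
  adj₀ : ∀ z, G.Adj (U z) (V z)
  adj₁ : ∀ z, G.Adj (U z) (V (z + c))
  adjU : ∀ z, G.Adj (U z) (U (z + a))
  adjV : ∀ z, G.Adj (V z) (V (z + b))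
  ker : ∀ z, π z = 0 ↔ z ∈ AddSubgroup.zmultiples c
  ne_zero : c ≠ 0
  surj : Function.Surjective π

/-- The vertices lying over a given element of the quotient. -/
def row (U V : A → W) (π : A →+ K) (r : K) : Set W :=
  {x | ∃ w, π w = r ∧ (x = U w ∨ x = V w)}

/-- Adjacency of `U z` and `V y`. -/
def Spoke (c z y : A) : Prop := y = z ∨ y = z + c

/-- The path of length `2 * i + 1` starting at `U x` and going through `V (x + c)`. -/
def arc (U V : A → W) (c : A) : A → ℕ → List W
  | x, 0 => [U x, V (x + c)]
  | x, i + 1 => U x :: V (x + c) :: arc U V c (x + c) i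

/-- A path from `U z` to `V y` through all vertices of a row, using only spokes. -/
structure RowPath (G : SimpleGraph W) (U V : A → W) (c : A) (π : A →+ K) (z y : A)
    (N : List W) : Prop where
  form : ∃ t, N = U z :: t ++ [V y]
  nodup : N.Nodup
  mem : ∀ x, x ∈ N ↔ x ∈ row U V π (π z)
  edges : pathEdges N ⊆ G.edgeSet
  spokes : ∀ w w', π w = π z → Spoke c w w' → s(U w, V w') ≠ s(U z, V y) →
    s(U w, V w') ∈ pathEdges N

variable {G : SimpleGraph W} {U V : A → W} {a b c : A} {π : A →+ K}

theorem Rose.map_c (h : Rose G U V a b c π) : π c = 0 :=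
  (h.ker c).2 (AddSubgroup.mem_zmultiples c)

theorem Rose.map_spoke (h : Rose G U V a b c π) {z y : A} (hz : Spoke c z y) : π y = π z := by
  rcases hz with rfl | rfl
  · rfl
  · rw [map_add, h.map_c, add_zero]

theorem Rose.adj_spoke (h : Rose G U V a b c π) {z y : A} (hz : Spoke c z y) :
    G.Adj (U z) (V y) := by
  rcases hz with rfl | rfl
  · exact h.adj₀ _
  · exact h.adj₁ _

theorem Rose.neg_left (h : Rose G U V a b c π) : Rose G U V (-a) b c π :=
  { h with adjU := fun z => by simpa using (h.adjU (z + -a)).symm }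

theorem Rose.neg_right (h : Rose G U V a b c π) : Rose G U V a (-b) c π :=
  { h with adjV := fun z => by simpa using (h.adjV (z + -b)).symm }

theorem Rose.dual (h : Rose G U V a b c π) : Rose G V U b a (-c) π where
  injU := h.injV
  injV := h.injU
  ne z w := (h.ne w z).symm
  adj₀ z := (h.adj₀ z).symm
  adj₁ z := by simpa using (h.adj₁ (z + -c)).symm
  adjU := h.adjV
  adjV := h.adjU
  ker z := by rw [h.ker, AddSubgroup.zmultiples_neg]
  ne_zero := neg_ne_zero.2 h.ne_zero
  surj := h.surj

theorem Rose.reflect (h : Rose G U V a b c π) :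
    Rose G (fun z => U (-z)) (fun z => V (c - z)) a b c (-π) where
  injU := h.injU.comp neg_injective
  injV := h.injV.comp sub_right_injective
  ne z w := h.ne _ _
  adj₀ z := by simpa [sub_eq_neg_add] using h.adj₁ (-z)
  adj₁ z := by simpa using h.adj₀ (-z)
  adjU z := by simpa using (h.adjU (-(z + a))).symm
  adjV z := by simpa [sub_add_eq_sub_sub] using (h.adjV (c - (z + b))).symm
  ker z := by simpa using h.ker z
  ne_zero := h.ne_zero
  surj r := by
    obtain ⟨z, hz⟩ := h.surj (-r)
    exact ⟨z, by simp [hz]⟩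

theorem row_dual (r : K) : row V U π r = row U V π r := by
  ext x
  simp only [row, Set.mem_ofPred_eq, or_comm]

theorem Rose.row_reflect (h : Rose G U V a b c π) (r : K) :
    row (fun z => U (-z)) (fun z => V (c - z)) (-π) r = row U V π r := by
  ext x
  simp only [row, Set.mem_ofPred_eq, AddMonoidHom.neg_apply]
  constructor
  · rintro ⟨w, hw, rfl | rfl⟩
    · exact ⟨-w, by simpa using hw, Or.inl rfl⟩
    · exact ⟨c - w, by simpa [h.map_c] using hw, Or.inr rfl⟩
  · rintro ⟨w, hw, rfl | rfl⟩
    · exact ⟨-w, by simpa using hw, Or.inl (by simp)⟩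
    · exact ⟨c - w, by simpa [h.map_c] using hw, Or.inr (by simp)⟩

theorem Rose.map_eq [Finite A] (h : Rose G U V a b c π) {z w : A} :
    π w = π z ↔ ∃ j < addOrderOf c, w = z + j • c := by
  constructor
  · classical
    intro e
    have h1 : w - z ∈ AddSubgroup.zmultiples c := (h.ker _).1 (by simp [e])
    rw [mem_zmultiples_iff_mem_range_addOrderOf] at h1
    simp only [Finset.mem_image, Finset.mem_range] at h1
    obtain ⟨j, hj, e⟩ := h1
    exact ⟨j, hj, by rw [e]; abel⟩
  · rintro ⟨j, _, rfl⟩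
    simp [h.map_c]

theorem Rose.two_le [Finite A] (h : Rose G U V a b c π) : 2 ≤ addOrderOf c := by
  have h1 := addOrderOf_pos c
  have h2 : addOrderOf c ≠ 1 := fun e => h.ne_zero (AddMonoid.addOrderOf_eq_one_iff.1 e)
  omega

theorem add_add_nsmul (x c : A) (j : ℕ) : x + c + j • c = x + (j + 1) • c := by
  rw [succ_nsmul']; abel

theorem arc_eq (x : A) (i : ℕ) :
    ∃ t, arc U V c x i = U x :: t ++ [V (x + (i + 1) • c)] := by
  induction i generalizing x with
  | zero => exact ⟨[], by simp [arc]⟩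
  | succ i ih =>
    obtain ⟨t, ht⟩ := ih (x + c)
    refine ⟨V (x + c) :: U (x + c) :: t, ?_⟩
    rw [arc, ht]
    simp only [List.cons_append]
    congr 6
    simp only [add_smul, one_smul]; abel

theorem arc_append (x : A) (i j : ℕ) :
    arc U V c x (i + j + 1) = arc U V c x i ++ arc U V c (x + (i + 1) • c) j := by
  induction i generalizing x with
  | zero => simp [arc]
  | succ i ih =>
    rw [show i + 1 + j + 1 = (i + j + 1) + 1 by ring, arc, ih, arc]
    simp only [List.cons_append]
    congr 4
    simp only [add_smul, one_smul]; abel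

theorem mem_arc (x : A) (i : ℕ) (y : W) : y ∈ arc U V c x i ↔
    ∃ j ≤ i, y = U (x + j • c) ∨ y = V (x + (j + 1) • c) := by
  induction i generalizing x with
  | zero => simp [arc]
  | succ i ih =>
    rw [arc, List.mem_cons, List.mem_cons, ih]
    constructor
    · rintro (rfl | rfl | ⟨j, hj, h⟩)
      · exact ⟨0, by omega, by simp⟩
      · exact ⟨0, by omega, by simp⟩
      · refine ⟨j + 1, by omega, ?_⟩
        convert h using 3 <;> (simp only [add_smul, one_smul]; abel)
    · rintro ⟨j, hj, h⟩
      cases j with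
      | zero => simp at h; tauto
      | succ j =>
        refine Or.inr (Or.inr ⟨j, by omega, ?_⟩)
        convert h using 3 <;> (simp only [add_smul, one_smul]; abel)

theorem Rose.nodup_arc [Finite A] (h : Rose G U V a b c π) (x : A) (i : ℕ)
    (hi : i < addOrderOf c) : (arc U V c x i).Nodup := by
  have key : ∀ j, 0 < j → j < addOrderOf c → j • c ≠ 0 := fun j h0 h1 e =>
    absurd (Nat.le_of_dvd h0 (addOrderOf_dvd_of_nsmul_eq_zero e)) (by omega)
  induction i generalizing x with
  | zero => simp [arc, h.ne]
  | succ i ih =>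
    rw [arc, List.nodup_cons, List.nodup_cons, List.mem_cons, mem_arc, mem_arc]
    refine ⟨?_, ?_, ih _ (by omega)⟩
    · rintro (e | ⟨j, hj, e | e⟩)
      · exact h.ne _ _ e
      · have := h.injU e
        refine key (j + 1) (by omega) (by omega) ?_
        rw [add_assoc, left_eq_add] at this
        rw [← this]; simp only [add_smul, one_smul]; abel
      · exact h.ne _ _ e
    · rintro ⟨j, hj, e | e⟩
      · exact h.ne _ _ e.symm
      · have := h.injV e
        rw [left_eq_add] at this
        exact key (j + 1) (by omega) (by omega) this

theorem Rose.edges_arc (h : Rose G U V a b c π) (x : A) (i : ℕ) :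
    pathEdges (arc U V c x i) ⊆ G.edgeSet := by
  induction i generalizing x with
  | zero =>
    simp only [arc, pathEdges_cons_cons, pathEdges_singleton, Set.insert_subset_iff]
    exact ⟨h.adj₁ x, Set.empty_subset _⟩
  | succ i ih =>
    obtain ⟨t, ht⟩ := arc_eq (U := U) (V := V) (c := c) (x + c) i
    have := ih (x + c)
    rw [arc]
    rw [ht] at this ⊢
    simp only [List.cons_append, pathEdges_cons_cons, Set.insert_subset_iff] at this ⊢
    exact ⟨h.adj₁ x, (h.adj₀ _).symm, this⟩

theorem arc_spokes₁ (x : A) (i j : ℕ) (hj : j ≤ i) :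
    s(U (x + j • c), V (x + (j + 1) • c)) ∈ pathEdges (arc U V c x i) := by
  induction i generalizing x j with
  | zero => obtain rfl : j = 0 := by omega
            simp [arc]
  | succ i ih =>
    obtain ⟨t, ht⟩ := arc_eq (U := U) (V := V) (c := c) (x + c) i
    cases j with
    | zero => simp [arc]
    | succ j =>
      have := ih (x + c) j (by omega)
      rw [add_add_nsmul, add_add_nsmul] at this
      rw [arc]
      rw [ht] at this ⊢
      simp only [List.cons_append, pathEdges_cons_cons] at this ⊢
      refine Or.inr (Or.inr ?_)
      exact this

theorem arc_spokes₀ (x : A) (i j : ℕ) (hj : j < i) :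
    s(U (x + (j + 1) • c), V (x + (j + 1) • c)) ∈ pathEdges (arc U V c x i) := by
  induction i generalizing x j with
  | zero => omega
  | succ i ih =>
    obtain ⟨t, ht⟩ := arc_eq (U := U) (V := V) (c := c) (x + c) i
    rw [arc]
    cases j with
    | zero =>
      rw [ht]
      simp only [List.cons_append, pathEdges_cons_cons]
      refine Or.inr (Or.inl ?_)
      rw [Sym2.eq_swap]; simp
    | succ j =>
      have := ih (x + c) j (by omega)
      rw [add_add_nsmul] at this
      rw [ht] at this ⊢
      simp only [List.cons_append, pathEdges_cons_cons] at this ⊢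
      refine Or.inr (Or.inr ?_)
      exact this

theorem exists_arc_split (x : A) (i j : ℕ) (hj : j ≤ i) :
    ∃ P Q, arc U V c x i = P ++ U (x + j • c) :: V (x + (j + 1) • c) :: Q := by
  obtain ⟨P, Q, h⟩ : ∃ P Q, arc U V c x i = P ++ (arc U V c (x + j • c) 0 ++ Q) := by
    have h1 : ∃ Q, arc U V c (x + j • c) (i - j) = arc U V c (x + j • c) 0 ++ Q := by
      rcases Nat.eq_zero_or_pos (i - j) with h | h
      · exact ⟨[], by simp [h]⟩
      · obtain ⟨d, hd⟩ : ∃ d, i - j = 0 + d + 1 := ⟨i - j - 1, by omega⟩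
        exact ⟨_, by rw [hd, arc_append]⟩
    obtain ⟨Q, hQ⟩ := h1
    rcases Nat.eq_zero_or_pos j with rfl | h
    · exact ⟨[], Q, by simpa using hQ⟩
    · refine ⟨arc U V c x (j - 1), Q, ?_⟩
      rw [← hQ]
      have := arc_append (U := U) (V := V) (c := c) x (j - 1) (i - j)
      rw [show j - 1 + (i - j) + 1 = i by omega, Nat.sub_add_cancel h] at this
      exact this
  refine ⟨P, Q, ?_⟩
  rw [h]
  simp [arc, add_smul, add_assoc]

theorem Rose.rowPath_arc [Finite A] (h : Rose G U V a b c π) (z : A) :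
    RowPath G U V c π z z (arc U V c z (addOrderOf c - 1)) := by
  have h2 := h.two_le
  have hn : addOrderOf c - 1 + 1 = addOrderOf c := by omega
  refine ⟨?_, h.nodup_arc _ _ (by omega), fun x => ?_, h.edges_arc _ _, ?_⟩
  · obtain ⟨t, ht⟩ := arc_eq (U := U) (V := V) (c := c) z (addOrderOf c - 1)
    refine ⟨t, ?_⟩
    rw [ht, hn, addOrderOf_nsmul_eq_zero, add_zero]
  · rw [mem_arc]
    constructor
    · rintro ⟨j, _, rfl | rfl⟩
      · exact ⟨_, by simp [h.map_c], Or.inl rfl⟩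
      · exact ⟨_, by simp [h.map_c], Or.inr rfl⟩
    · rintro ⟨w, hw, rfl | rfl⟩
      · obtain ⟨j, hj, rfl⟩ := h.map_eq.1 hw
        exact ⟨j, by omega, Or.inl rfl⟩
      · obtain ⟨j, hj, rfl⟩ := h.map_eq.1 hw
        cases j with
        | zero =>
          refine ⟨addOrderOf c - 1, le_rfl, Or.inr ?_⟩
          rw [hn, addOrderOf_nsmul_eq_zero]; simp
        | succ j => exact ⟨j, by omega, Or.inr rfl⟩
  · rintro w w' hw hs hne
    obtain ⟨j, hj, rfl⟩ := h.map_eq.1 hw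
    rcases hs with rfl | rfl
    · cases j with
      | zero => simp at hne
      | succ j => exact arc_spokes₀ _ _ _ (by omega)
    · rw [add_assoc, ← succ_nsmul]
      exact arc_spokes₁ _ _ _ (by omega)

theorem Rose.exists_rowPath [Finite A] (h : Rose G U V a b c π) {z y : A} (hs : Spoke c z y) :
    ∃ N, RowPath G U V c π z y N := by
  rcases hs with rfl | rfl
  · exact ⟨_, h.rowPath_arc _⟩
  · have h1 := h.reflect.rowPath_arc (-z)
    refine ⟨_, ?_, h1.nodup, fun x => ?_, h1.edges, fun w w' hw hs hne => ?_⟩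
    · simpa [add_comm] using h1.form
    · rw [h1.mem, h.row_reflect]; simp
    · have := h1.spokes (-w) (c - w') (by simpa using hw) (by
        rcases hs with rfl | rfl
        · exact Or.inr (by abel)
        · exact Or.inl (by abel)) (by simpa [add_comm] using hne)
      simpa using this

end Rose

section Growth
variable {W A K : Type*} [AddCommGroup A] [AddCommGroup K]

/-- A cyclic list tracing a cycle through all vertices of the rows in `S`. -/
structure Cy (G : SimpleGraph W) (U V : A → W) (π : A →+ K) (S : Set K) (l : List W) :
    Prop where
  nodup : l.Nodup
  edges : cycleEdges l ⊆ G.edgeSet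
  mem : ∀ x, x ∈ l ↔ ∃ r ∈ S, x ∈ row U V π r

open Classical in
/-- The number of spokes at `U z` missing from an edge set. -/
noncomputable def missAt (E : Set (Sym2 W)) (U V : A → W) (c z : A) : ℕ :=
  (if s(U z, V z) ∈ E then 0 else 1) + (if s(U z, V (z + c)) ∈ E then 0 else 1)

open Classical in
/-- The number of spokes of a row missing from an edge set. -/
noncomputable def miss [Fintype A] (E : Set (Sym2 W)) (U V : A → W) (c : A) (π : A →+ K)
    (r : K) : ℕ :=
  ∑ z with π z = r, missAt E U V c z

/-- All spokes of the row `r`, except possibly the one joining `U z` to `V y`, are in `E`. -/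
def AlmostFull (E : Set (Sym2 W)) (U V : A → W) (c : A) (π : A →+ K) (r : K) (z y : A) : Prop :=
  ∀ w w', π w = r → Spoke c w w' → s(U w, V w') ≠ s(U z, V y) → s(U w, V w') ∈ E

variable {G : SimpleGraph W} {U V : A → W} {a b c : A} {π : A →+ K} {S T : Set K}
  {l l' N : List W} {E E' : Set (Sym2 W)} {r : K}

theorem pathEdges_cons_append_cons_cons (p x y : W) (t B : List W) :
    pathEdges (p :: (t ++ x :: y :: B)) =
      insert s(x, y) (pathEdges (p :: (t ++ [x])) ∪ pathEdges (y :: B)) := by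
  simpa using pathEdges_append_cons_cons (p :: t) B x y

theorem pathEdges_cons_reverse_append (x y : W) (t : List W) :
    pathEdges (x :: (t.reverse ++ [y])) = pathEdges (y :: (t ++ [x])) := by
  rw [← pathEdges_reverse (y :: (t ++ [x]))]; simp

theorem Rose.row_inj (h : Rose G U V a b c π) {r r' : K} {x : W} (h1 : x ∈ row U V π r)
    (h2 : x ∈ row U V π r') : r = r' := by
  obtain ⟨w, rfl, h1 | h1⟩ := h1 <;> obtain ⟨w', rfl, h2 | h2⟩ := h2
  · rw [h.injU (h1.symm.trans h2)]
  · exact absurd (h1.symm.trans h2) (h.ne _ _)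
  · exact absurd (h2.symm.trans h1) (h.ne _ _)
  · rw [h.injV (h1.symm.trans h2)]

theorem cy_dual : Cy G V U π S l ↔ Cy G U V π S l := by
  constructor <;> rintro ⟨h1, h2, h3⟩
  · exact ⟨h1, h2, by simpa only [row_dual] using h3⟩
  · exact ⟨h1, h2, by simpa only [row_dual (U := U)] using h3⟩

theorem miss_dual [Fintype A] (h : Rose G U V a b c π) :
    miss E V U (-c) π r = miss E U V c π r := by
  classical
  simp only [miss, missAt, Finset.sum_add_distrib]
  congr 1
  · refine Finset.sum_congr rfl fun z _ => ?_
    rw [Sym2.eq_swap]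
  · refine Finset.sum_equiv (Equiv.addRight (-c)) (fun z => ?_) (fun z _ => ?_)
    · simp [h.map_c]
    · rw [Sym2.eq_swap]
      simp

theorem miss_mono [Fintype A]
    (h : ∀ w w', π w = r → Spoke c w w' → s(U w, V w') ∈ E → s(U w, V w') ∈ E') :
    miss E' U V c π r ≤ miss E U V c π r := by
  classical
  refine Finset.sum_le_sum fun z hz => ?_
  have hz : π z = r := by simpa using hz
  have h1 := h z z hz (Or.inl rfl)
  have h2 := h z (z + c) hz (Or.inr rfl)
  unfold missAt
  split_ifs <;> first | omega | (exfalso; tauto)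

theorem Rose.miss_le_add_one [Fintype A] (hR : Rose G U V a b c π) {z₀ y₀ : A}
    (h : ∀ w w', π w = r → Spoke c w w' → s(U w, V w') ≠ s(U z₀, V y₀) →
      s(U w, V w') ∈ E → s(U w, V w') ∈ E') :
    miss E' U V c π r ≤ miss E U V c π r + 1 := by
  classical
  have key : ∀ z, π z = r → missAt E' U V c z ≤ missAt E U V c z + if z = z₀ then 1 else 0 := by
    intro z hz
    have h1 := h z z hz (Or.inl rfl)
    have h2 := h z (z + c) hz (Or.inr rfl)
    have e : z ≠ z + c := by simpa using hR.ne_zero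
    have e1 : s(U z, V z) = s(U z₀, V y₀) → z = z₀ ∧ z = y₀ := by
      rw [Sym2.eq_iff]
      rintro (⟨e1, e2⟩ | ⟨e1, _⟩)
      · exact ⟨hR.injU e1, hR.injV e2⟩
      · exact absurd e1 (hR.ne _ _)
    have e2 : s(U z, V (z + c)) = s(U z₀, V y₀) → z = z₀ ∧ z + c = y₀ := by
      rw [Sym2.eq_iff]
      rintro (⟨e1, e2⟩ | ⟨e1, _⟩)
      · exact ⟨hR.injU e1, hR.injV e2⟩
      · exact absurd e1 (hR.ne _ _)
    unfold missAt
    by_cases h3 : s(U z, V z) = s(U z₀, V y₀)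
    · have h4 : s(U z, V (z + c)) ≠ s(U z₀, V y₀) := fun h5 =>
        e ((e1 h3).2.trans (e2 h5).2.symm)
      have := h2 h4
      rw [if_pos (e1 h3).1]
      split_ifs <;> first | omega | (exfalso; tauto)
    · by_cases h4 : s(U z, V (z + c)) = s(U z₀, V y₀)
      · have := h1 h3
        rw [if_pos (e2 h4).1]
        split_ifs <;> first | omega | (exfalso; tauto)
      · have := h1 h3
        have := h2 h4
        split_ifs <;> first | omega | (exfalso; tauto)
  have : miss E' U V c π r ≤
      ∑ z with π z = r, (missAt E U V c z + if z = z₀ then 1 else 0) :=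
    Finset.sum_le_sum fun z hz => key z (by simpa using hz)
  rw [Finset.sum_add_distrib] at this
  refine this.trans (Nat.add_le_add_left ?_ _)
  rw [Finset.sum_ite_eq']
  split_ifs <;> omega

theorem Rose.miss_le_one [Fintype A] (hR : Rose G U V a b c π) {z₀ y₀ : A}
    (h : AlmostFull E U V c π r z₀ y₀) : miss E U V c π r ≤ 1 := by
  have := hR.miss_le_add_one (E := Set.univ) (E' := E) (r := r) (z₀ := z₀) (y₀ := y₀)
    (fun w w' h1 h2 h3 _ => h w w' h1 h2 h3)
  have e : miss Set.univ U V c π r = 0 := by simp [miss, missAt]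
  omega

theorem missAt_add_le [Fintype A] (hR : Rose G U V a b c π) (z : A) :
    missAt E U V c z + missAt E U V c (z + c) ≤ miss E U V c π (π z) := by
  classical
  have e : z ≠ z + c := by simpa using hR.ne_zero
  rw [← Finset.sum_pair (f := missAt E U V c) e]
  refine Finset.sum_le_sum_of_subset fun w hw => ?_
  simp only [Finset.mem_insert, Finset.mem_singleton] at hw
  rcases hw with rfl | rfl <;> simp [hR.map_c]

theorem missAt_eq_zero {z : A} (h : missAt E U V c z = 0) :
    s(U z, V z) ∈ E ∧ s(U z, V (z + c)) ∈ E := by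
  unfold missAt at h
  constructor
  · by_contra h1
    simp [h1] at h
  · by_contra h1
    simp [h1] at h

theorem exists_spoke_of_missAt {z : A} (h : missAt E U V c z ≤ 1) :
    ∃ y, Spoke c z y ∧ s(U z, V y) ∈ E := by
  unfold missAt at h
  by_cases h1 : s(U z, V z) ∈ E
  · exact ⟨z, Or.inl rfl, h1⟩
  · by_cases h2 : s(U z, V (z + c)) ∈ E
    · exact ⟨_, Or.inr rfl, h2⟩
    · simp [h1, h2] at h

theorem Rose.exists_spoke [Fintype A] (hR : Rose G U V a b c π) (z₀ : A)
    (h : miss E U V c π (π z₀) ≤ 3) :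
    ∃ z y, π z = π z₀ ∧ Spoke c z y ∧ s(U z, V y) ∈ E := by
  have h1 := missAt_add_le (E := E) hR z₀
  rcases Nat.lt_or_ge (missAt E U V c z₀) 2 with h2 | h2
  · obtain ⟨y, h3⟩ := exists_spoke_of_missAt (E := E) (z := z₀) (U := U) (V := V) (c := c)
      (by omega)
    exact ⟨_, y, rfl, h3⟩
  · obtain ⟨y, h3⟩ := exists_spoke_of_missAt (E := E) (z := z₀ + c) (U := U) (V := V) (c := c)
      (by omega)
    exact ⟨_, y, by simp [hR.map_c], h3⟩

theorem Cy.extend (hR : Rose G U V a b c π) (h : Cy G U V π S l) (hp : l'.Perm (l ++ N))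
    (hN : N.Nodup) (hm : ∀ x, x ∈ N ↔ ∃ r ∈ T, x ∈ row U V π r) (hST : ∀ r ∈ T, r ∉ S)
    (he : cycleEdges l' ⊆ G.edgeSet) : Cy G U V π (T ∪ S) l' := by
  refine ⟨hp.symm.nodup ?_, he, fun x => ?_⟩
  · rw [List.nodup_append]
    refine ⟨h.nodup, hN, fun x hx y hy => ?_⟩
    rintro rfl
    obtain ⟨r, hr, h1⟩ := (h.mem x).1 hx
    obtain ⟨r', hr', h2⟩ := (hm x).1 hy
    rw [hR.row_inj h1 h2] at hr
    exact hST _ hr' hr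
  · rw [hp.mem_iff, List.mem_append, h.mem, hm]
    constructor
    · rintro (⟨r, h1, h2⟩ | ⟨r, h1, h2⟩)
      · exact ⟨r, Or.inr h1, h2⟩
      · exact ⟨r, Or.inl h1, h2⟩
    · rintro ⟨r, h1 | h1, h2⟩
      · exact Or.inr ⟨r, h1, h2⟩
      · exact Or.inl ⟨r, h1, h2⟩

theorem spoke_add {z y : A} (h : Spoke c z y) (d : A) : Spoke c (z + d) (y + d) := by
  rcases h with rfl | rfl
  · exact Or.inl rfl
  · exact Or.inr (by abel)

theorem RowPath.almostFull {z y : A} (h : RowPath G U V c π z y N) (hE : pathEdges N ⊆ E) :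
    AlmostFull E U V c π (π z) z y :=
  fun w w' h1 h2 h3 => hE (h.spokes w w' h1 h2 h3)

theorem Rose.disjoint_rowPath (hR : Rose G U V a b c π) {z y z' y' : A} {N' : List W}
    (h : RowPath G U V c π z y N) (h' : RowPath G U V c π z' y' N') (hz : π z ≠ π z') :
    ∀ x ∈ N, ∀ x' ∈ N', x ≠ x' := by
  rintro x hx _ hx' rfl
  exact hz (hR.row_inj ((h.mem x).1 hx) ((h'.mem x).1 hx'))

/-- Inserting a detour through three rows. -/
theorem Rose.square_insert [Finite A] (hR : Rose G U V a b c π) (hl : Cy G U V π S l) {z y : A}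
    (hs : Spoke c z y) (he : s(U z, V y) ∈ cycleEdges l) (ha : π a ≠ 0) (hb : π b ≠ 0)
    (hab : π a ≠ π b) (h₁ : π (z + a) ∉ S) (h₂ : π (z + a + b) ∉ S) (h₃ : π (z + b) ∉ S) :
    ∃ l', Cy G U V π ({π (z + a), π (z + a + b), π (z + b)} ∪ S) l' ∧
      cycleEdges l \ {s(U z, V y)} ⊆ cycleEdges l' ∧
      AlmostFull (cycleEdges l') U V c π (π (z + a)) (z + a) (y + a) ∧
      AlmostFull (cycleEdges l') U V c π (π (z + a + b)) (z + a + b) (y + a + b) ∧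
      AlmostFull (cycleEdges l') U V c π (π (z + b)) (z + b) (y + b) := by
  obtain ⟨N₁, hN₁⟩ := hR.exists_rowPath (spoke_add hs a)
  obtain ⟨N₂, hN₂⟩ := hR.exists_rowPath (spoke_add (spoke_add hs a) b)
  obtain ⟨N₃, hN₃⟩ := hR.exists_rowPath (spoke_add hs b)
  obtain ⟨l', hp, h1, h2, h3⟩ := exists_insert (hR.ne _ _) he (N₁ ++ N₂.reverse ++ N₃)
  have hpe : pathEdges (U z :: (N₁ ++ N₂.reverse ++ N₃) ++ [V y]) =
      {s(U z, U (z + a)), s(V (y + a), V (y + a + b)), s(U (z + a + b), U (z + b)),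
        s(V (y + b), V y)} ∪ (pathEdges N₁ ∪ pathEdges N₂ ∪ pathEdges N₃) := by
    obtain ⟨t₁, rfl⟩ := hN₁.form
    obtain ⟨t₂, rfl⟩ := hN₂.form
    obtain ⟨t₃, rfl⟩ := hN₃.form
    simp only [List.cons_append, List.append_assoc, List.nil_append, List.reverse_cons,
      List.reverse_append, List.reverse_nil, pathEdges_cons_cons, pathEdges_singleton,
      pathEdges_cons_append_cons_cons, pathEdges_cons_reverse_append]
    ext e
    simp only [Set.mem_insert_iff, Set.mem_union, Set.mem_singleton_iff, Set.mem_empty_iff_false]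
    tauto
  rw [hpe] at h1 h3
  have d12 : π (z + a) ≠ π (z + a + b) := by simpa using hb
  have d13 : π (z + a) ≠ π (z + b) := by simpa using hab
  have d23 : π (z + a + b) ≠ π (z + b) := by simpa [add_right_comm] using ha
  refine ⟨l', hl.extend hR hp ?_ ?_ ?_ ?_, h2, ?_, ?_, ?_⟩
  · rw [List.nodup_append, List.nodup_append]
    refine ⟨⟨hN₁.nodup, List.nodup_reverse.2 hN₂.nodup, fun x hx x' hx' => ?_⟩, hN₃.nodup,
      fun x hx x' hx' => ?_⟩
    · exact hR.disjoint_rowPath hN₁ hN₂ d12 x hx x' (List.mem_reverse.1 hx')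
    · rcases List.mem_append.1 hx with hx | hx
      · exact hR.disjoint_rowPath hN₁ hN₃ d13 x hx x' hx'
      · exact hR.disjoint_rowPath hN₂ hN₃ d23 x (List.mem_reverse.1 hx) x' hx'
  · intro x
    simp [hN₁.mem, hN₂.mem, hN₃.mem]
  · rintro r (rfl | rfl | rfl) <;> assumption
  · refine h1.trans (Set.union_subset hl.edges (Set.union_subset ?_ (Set.union_subset
      (Set.union_subset hN₁.edges hN₂.edges) hN₃.edges)))
    simp only [Set.insert_subset_iff, Set.singleton_subset_iff, SimpleGraph.mem_edgeSet]
    refine ⟨hR.adjU z, hR.adjV _, ?_, (hR.adjV _).symm⟩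
    simpa [add_right_comm] using (hR.adjU (z + b)).symm
  · exact hN₁.almostFull fun e he => h3 (Or.inr (Or.inl (Or.inl he)))
  · exact hN₂.almostFull fun e he => h3 (Or.inr (Or.inl (Or.inr he)))
  · exact hN₃.almostFull fun e he => h3 (Or.inr (Or.inr he))

/-- Extending a cycle from two adjacent rows to the two rows above them. -/
theorem Rose.square_two_opt [Finite A] (hR : Rose G U V a b c π) (hl : Cy G U V π S l) {z y : A}
    (hs : Spoke c (z + a) y) (he : s(U (z + a), V y) ∈ cycleEdges l)
    (h₀ : s(U z, V z) ∈ cycleEdges l) (h₀' : s(U z, V (z + c)) ∈ cycleEdges l)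
    (ha : π a ≠ 0) (h₁ : π (z + b) ∉ S) (h₂ : π (z + a + b) ∉ S) :
    ∃ x l', Cy G U V π ({π (z + b), π (z + a + b)} ∪ S) l' ∧
      cycleEdges l \ {s(U (z + a), V y), s(U z, V x)} ⊆ cycleEdges l' ∧
      AlmostFull (cycleEdges l') U V c π (π (z + b)) (z + b) (x + b) ∧
      AlmostFull (cycleEdges l') U V c π (π (z + a + b)) (z + a + b) (y + b) := by
  have hz : z ≠ z + a := fun e => ha (by simpa using congrArg π e)
  have hc : z ≠ z + c := by simpa using hR.ne_zero
  obtain ⟨q, hx, hN⟩ := exists_two_opt hl.nodup he h₀ h₀' (hR.injV.ne hc) (hR.injU.ne hz)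
    (hR.ne _ _) (hR.ne _ _)
  obtain ⟨x, hsx, rfl⟩ : ∃ x, Spoke c z x ∧ V x = q := by
    rcases hx with rfl | rfl
    · exact ⟨_, Or.inl rfl, rfl⟩
    · exact ⟨_, Or.inr rfl, rfl⟩
  obtain ⟨N₁, hN₁⟩ := hR.exists_rowPath (spoke_add hsx b)
  obtain ⟨N₂, hN₂⟩ := hR.exists_rowPath (spoke_add hs b)
  obtain ⟨l', hp, h1, h2, h3⟩ := hN (N₂.reverse ++ N₁)
  have hpe : pathEdges (V y :: (N₂.reverse ++ N₁) ++ [V x]) =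
      {s(V y, V (y + b)), s(U (z + a + b), U (z + b)), s(V (x + b), V x)} ∪
        (pathEdges N₁ ∪ pathEdges N₂) := by
    obtain ⟨t₁, rfl⟩ := hN₁.form
    obtain ⟨t₂, rfl⟩ := hN₂.form
    simp only [List.cons_append, List.append_assoc, List.nil_append, List.reverse_cons,
      List.reverse_append, List.reverse_nil, pathEdges_cons_cons, pathEdges_singleton,
      pathEdges_cons_append_cons_cons, pathEdges_cons_reverse_append]
    ext e
    simp only [Set.mem_insert_iff, Set.mem_union, Set.mem_singleton_iff, Set.mem_empty_iff_false]
    tauto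
  rw [hpe] at h1 h3
  have d12 : π (z + b) ≠ π (z + a + b) := by simpa [add_right_comm] using ha
  refine ⟨x, l', hl.extend hR hp ?_ ?_ ?_ ?_, h2, ?_, ?_⟩
  · rw [List.nodup_append]
    refine ⟨List.nodup_reverse.2 hN₂.nodup, hN₁.nodup, fun x hx x' hx' => ?_⟩
    exact (hR.disjoint_rowPath hN₁ hN₂ d12 x' hx' x (List.mem_reverse.1 hx)).symm
  · intro x
    simp [hN₁.mem, hN₂.mem, or_comm]
  · rintro r (rfl | rfl) <;> assumption
  · refine h1.trans (Set.union_subset (Set.union_subset hl.edges ?_) (Set.union_subset ?_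
      (Set.union_subset hN₁.edges hN₂.edges)))
    · simpa using hR.adjU z
    · simp only [Set.insert_subset_iff, Set.singleton_subset_iff, SimpleGraph.mem_edgeSet]
      refine ⟨hR.adjV _, ?_, (hR.adjV _).symm⟩
      simpa [add_right_comm] using (hR.adjU (z + b)).symm
  · exact hN₁.almostFull fun e he => h3 (Or.inr (Or.inl he))
  · exact hN₂.almostFull fun e he => h3 (Or.inr (Or.inr he))

end Growth

section Frame
variable {W A K : Type*} [AddCommGroup A] [AddCommGroup K]

/-- There is a cycle through the rows with indices in `S`, with few missing spokes. -/
def Grown [Fintype A] (G : SimpleGraph W) (U V : A → W) (c : A) (π : A →+ K) (cell : ℕ → K)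
    (k : ℕ) (S : ℕ → Prop) (f : ℕ → ℕ) : Prop :=
  (∀ i, S i → i < k) ∧ ∃ l, Cy G U V π {r | ∃ i, S i ∧ cell i = r} l ∧
    ∀ i, S i → miss (cycleEdges l) U V c π (cell i) ≤ f i

variable {G : SimpleGraph W} {U V : A → W} {a b c : A} {π : A →+ K}
  {cell : ℕ → K} {k : ℕ} {S S' : ℕ → Prop} {f f' : ℕ → ℕ}

theorem Grown.mono [Fintype A] (h : Grown G U V c π cell k S f) (hS : ∀ i, S' i ↔ S i)
    (hf : ∀ i, S i → f i ≤ f' i) : Grown G U V c π cell k S' f' := by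
  obtain ⟨h1, l, h2, h3⟩ := h
  have : S' = S := funext fun i => propext (hS i)
  subst this
  exact ⟨h1, l, h2, fun i hi => (h3 i hi).trans (hf i hi)⟩

theorem Grown.dual [Fintype A] (hR : Rose G U V a b c π) (h : Grown G U V c π cell k S f) :
    Grown G V U (-c) π cell k S f := by
  obtain ⟨h1, l, h2, h3⟩ := h
  exact ⟨h1, l, cy_dual.2 h2, fun i hi => by rw [miss_dual hR]; exact h3 i hi⟩

theorem Grown.of_dual [Fintype A] (hR : Rose G U V a b c π)
    (h : Grown G V U (-c) π cell k S f) : Grown G U V c π cell k S f := by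
  simpa using h.dual hR.dual

theorem Grown.insert [Fintype A] (hR : Rose G U V a b c π)
    (inj : ∀ i < k, ∀ j < k, cell i = cell j → i = j)
    (h : Grown G U V c π cell k S f) {r p q s : ℕ}
    (hp : cell p = cell r + π a) (hq : cell q = cell r + π a + π b) (hs : cell s = cell r + π b)
    (hr : S r) (hfr : f r ≤ 3) (hp₀ : ¬ S p) (hq₀ : ¬ S q) (hs₀ : ¬ S s)
    (hk : p < k ∧ q < k ∧ s < k) (hps : p ≠ s)
    (hS : ∀ i, S' i ↔ i = p ∨ i = q ∨ i = s ∨ S i)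
    (hf : f r + 1 ≤ f' r ∧ 1 ≤ f' p ∧ 1 ≤ f' q ∧ 1 ≤ f' s)
    (hf' : ∀ i, S i → i ≠ r → f i ≤ f' i) : Grown G U V c π cell k S' f' := by
  obtain ⟨hlt, l, hl, hm⟩ := h
  have inj' : ∀ i < k, cell i ∈ {r | ∃ i, S i ∧ cell i = r} → S i := by
    rintro i hi ⟨j, hj, e⟩
    rwa [← inj j (hlt _ hj) i hi e]
  have hrk := hlt r hr
  have hpr : p ≠ r := fun e => hp₀ (e ▸ hr)
  have hsr : s ≠ r := fun e => hs₀ (e ▸ hr)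
  have ha : π a ≠ 0 := fun e => hpr (inj p hk.1 r hrk (by rw [hp, e, add_zero]))
  have hb : π b ≠ 0 := fun e => hsr (inj s hk.2.2 r hrk (by rw [hs, e, add_zero]))
  have hab : π a ≠ π b := fun e => hps (inj p hk.1 s hk.2.2 (by rw [hp, e, hs]))
  obtain ⟨z₀, hz₀⟩ := hR.surj (cell r)
  obtain ⟨z, y, hz, hsp, he⟩ := hR.exists_spoke (E := cycleEdges l) z₀
    (by rw [hz₀]; exact (hm r hr).trans hfr)
  rw [hz₀] at hz
  have hp' : π (z + a) = cell p := by rw [map_add, hz, hp]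
  have hq' : π (z + a + b) = cell q := by rw [map_add, map_add, hz, hq]
  have hs' : π (z + b) = cell s := by rw [map_add, hz, hs]
  obtain ⟨l', hl', h0, h1, h2, h3⟩ := hR.square_insert hl hsp he ha hb hab
    (by rw [hp']; exact fun hh => hp₀ (inj' p hk.1 hh))
    (by rw [hq']; exact fun hh => hq₀ (inj' q hk.2.1 hh))
    (by rw [hs']; exact fun hh => hs₀ (inj' s hk.2.2 hh))
  rw [hp', hq', hs'] at hl'
  rw [hp'] at h1
  rw [hq'] at h2
  rw [hs'] at h3
  refine ⟨fun i hi => ?_, l', ?_, fun i hi => ?_⟩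
  · rcases (hS i).1 hi with rfl | rfl | rfl | hi
    exacts [hk.1, hk.2.1, hk.2.2, hlt i hi]
  · convert hl' using 1
    ext r'
    simp only [hS, Set.mem_union, Set.mem_insert_iff, Set.mem_singleton_iff, Set.mem_ofPred_eq]
    constructor
    · rintro ⟨i, rfl | rfl | rfl | hi, rfl⟩
      · tauto
      · tauto
      · tauto
      · exact Or.inr ⟨i, hi, rfl⟩
    · rintro ((rfl | rfl | rfl) | ⟨i, hi, rfl⟩)
      · exact ⟨p, by tauto⟩
      · exact ⟨q, by tauto⟩
      · exact ⟨s, by tauto⟩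
      · exact ⟨i, by tauto⟩
  · rcases (hS i).1 hi with rfl | rfl | rfl | hi
    · exact (hR.miss_le_one h1).trans hf.2.1
    · exact (hR.miss_le_one h2).trans hf.2.2.1
    · exact (hR.miss_le_one h3).trans hf.2.2.2
    · by_cases hir : i = r
      · subst hir
        refine le_trans (hR.miss_le_add_one (E := cycleEdges l) (z₀ := z) (y₀ := y) ?_)
          ((Nat.add_le_add_right (hm i hi) 1).trans hf.1)
        intro w w' _ _ hne hmem
        exact h0 ⟨hmem, hne⟩
      · refine (miss_mono (E := cycleEdges l) ?_).trans ((hm i hi).trans (hf' i hi hir))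
        intro w w' hw hsp' hmem
        refine h0 ⟨hmem, fun e => hir (inj i (hlt i hi) r hrk ?_)⟩
        rcases Sym2.eq_iff.1 e with ⟨e, _⟩ | ⟨e, _⟩
        · rw [← hw, ← hz, hR.injU e]
        · exact absurd e (hR.ne _ _)

theorem Grown.extend [Fintype A] (hR : Rose G U V a b c π)
    (inj : ∀ i < k, ∀ j < k, cell i = cell j → i = j)
    (h : Grown G U V c π cell k S f) {r p q s : ℕ}
    (hp : cell p = cell r + π a) (hq : cell q = cell r + π a + π b) (hs : cell s = cell r + π b)
    (hr : S r) (hp₀ : S p) (hfr : f r + f p ≤ 3) (hpr : p ≠ r) (hq₀ : ¬ S q) (hs₀ : ¬ S s)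
    (hk : q < k ∧ s < k) (hS : ∀ i, S' i ↔ i = q ∨ i = s ∨ S i)
    (hf : f r + 1 ≤ f' r ∧ f p + 1 ≤ f' p ∧ 1 ≤ f' q ∧ 1 ≤ f' s)
    (hf' : ∀ i, S i → i ≠ r → i ≠ p → f i ≤ f' i) : Grown G U V c π cell k S' f' := by
  obtain ⟨hlt, l, hl, hm⟩ := h
  have hrk := hlt r hr
  have hpk := hlt p hp₀
  have ha : π a ≠ 0 := fun e => hpr (inj p hpk r hrk (by rw [hp, e, add_zero]))
  have inj' : ∀ i < k, cell i ∈ {r | ∃ i, S i ∧ cell i = r} → S i := by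
    rintro i hi ⟨j, hj, e⟩
    rwa [← inj j (hlt _ hj) i hi e]
  -- the conclusion, once the two rows have been added
  have fin : ∀ l' z y z' y' z₁ y₁ z₂ y₂, π z = cell r → π z' = cell p →
      Cy G U V π ({cell q, cell s} ∪ {r | ∃ i, S i ∧ cell i = r}) l' →
      cycleEdges l \ {s(U z, V y), s(U z', V y')} ⊆ cycleEdges l' →
      AlmostFull (cycleEdges l') U V c π (cell q) z₁ y₁ →
      AlmostFull (cycleEdges l') U V c π (cell s) z₂ y₂ → Grown G U V c π cell k S' f' := by
    intro l' z y z' y' z₁ y₁ z₂ y₂ hz hz' hl' h0 h1 h2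
    have huv : ∀ {w w' z y}, s(U w, V w') = s(U z, V y) → w = z := by
      intro w w' z y e
      rcases Sym2.eq_iff.1 e with ⟨e, _⟩ | ⟨e, _⟩
      · exact hR.injU e
      · exact absurd e (hR.ne _ _)
    refine ⟨fun i hi => ?_, l', ?_, fun i hi => ?_⟩
    · rcases (hS i).1 hi with rfl | rfl | hi
      exacts [hk.1, hk.2, hlt i hi]
    · convert hl' using 1
      ext r'
      simp only [hS, Set.mem_union, Set.mem_insert_iff, Set.mem_singleton_iff, Set.mem_ofPred_eq]
      constructor
      · rintro ⟨i, rfl | rfl | hi, rfl⟩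
        · tauto
        · tauto
        · exact Or.inr ⟨i, hi, rfl⟩
      · rintro ((rfl | rfl) | ⟨i, hi, rfl⟩)
        · exact ⟨q, by tauto⟩
        · exact ⟨s, by tauto⟩
        · exact ⟨i, by tauto⟩
    · rcases (hS i).1 hi with rfl | rfl | hi
      · exact (hR.miss_le_one h1).trans hf.2.2.1
      · exact (hR.miss_le_one h2).trans hf.2.2.2
      · have hcell : cell r ≠ cell p := fun e => hpr (inj p hpk r hrk e.symm)
        by_cases hir : i = r
        · subst hir
          refine le_trans (hR.miss_le_add_one (E := cycleEdges l) (z₀ := z) (y₀ := y) ?_)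
            ((Nat.add_le_add_right (hm i hi) 1).trans hf.1)
          intro w w' hw _ hne hmem
          refine h0 ⟨hmem, ?_⟩
          rintro (e | e)
          · exact hne e
          · exact hcell (by rw [← hw, huv e, hz'])
        by_cases hip : i = p
        · subst hip
          refine le_trans (hR.miss_le_add_one (E := cycleEdges l) (z₀ := z') (y₀ := y') ?_)
            ((Nat.add_le_add_right (hm i hi) 1).trans hf.2.1)
          intro w w' hw _ hne hmem
          refine h0 ⟨hmem, ?_⟩
          rintro (e | e)
          · exact hcell (by rw [← hw, huv e, hz])
          · exact hne e
        · refine (miss_mono (E := cycleEdges l) ?_).trans ((hm i hi).trans (hf' i hi hir hip))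
          intro w w' hw hsp' hmem
          refine h0 ⟨hmem, ?_⟩
          rintro (e | e)
          · exact hir (inj i (hlt i hi) r hrk (by rw [← hw, huv e, hz]))
          · exact hip (inj i (hlt i hi) p hpk (by rw [← hw, huv e, hz']))
  obtain ⟨z₀, hz₀⟩ := hR.surj (cell r)
  have key : ∃ z, π z = cell r ∧
      missAt (cycleEdges l) U V c z + missAt (cycleEdges l) U V c (z + a) ≤ 1 := by
    have e1 := missAt_add_le (E := cycleEdges l) hR z₀
    have e2 := missAt_add_le (E := cycleEdges l) hR (z₀ + a)
    rw [map_add, hz₀, ← hp] at e2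
    rw [hz₀] at e1
    have e3 := hm r hr
    have e4 := hm p hp₀
    rw [add_right_comm] at e2
    by_cases h5 : missAt (cycleEdges l) U V c z₀ + missAt (cycleEdges l) U V c (z₀ + a) ≤ 1
    · exact ⟨z₀, hz₀, h5⟩
    · exact ⟨z₀ + c, by rw [map_add, hR.map_c, hz₀, add_zero], by omega⟩
  obtain ⟨z, hz, hma⟩ := key
  have hp' : π (z + a) = cell p := by rw [map_add, hz, hp]
  have hq' : π (z + a + b) = cell q := by rw [map_add, map_add, hz, hq]
  have hs' : π (z + b) = cell s := by rw [map_add, hz, hs]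
  have hqS : π (z + a + b) ∉ {r | ∃ i, S i ∧ cell i = r} := by
    rw [hq']; exact fun hh => hq₀ (inj' q hk.1 hh)
  have hsS : π (z + b) ∉ {r | ∃ i, S i ∧ cell i = r} := by
    rw [hs']; exact fun hh => hs₀ (inj' s hk.2 hh)
  rcases Nat.eq_zero_or_pos (missAt (cycleEdges l) U V c z) with h0 | h0
  · obtain ⟨h1, h2⟩ := missAt_eq_zero h0
    obtain ⟨y, hy, he⟩ := exists_spoke_of_missAt (E := cycleEdges l) (U := U) (V := V) (c := c)
      (z := z + a) (by omega)
    obtain ⟨x, l', hl', h3, h4, h5⟩ := hR.square_two_opt hl hy he h1 h2 ha hsS hqS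
    rw [hq', hs', Set.pair_comm] at hl'
    rw [hq'] at h5
    rw [hs'] at h4
    rw [Set.pair_comm] at h3
    exact fin l' z x (z + a) y _ _ _ _ hz hp' hl' h3 h5 h4
  · obtain ⟨h1, h2⟩ := missAt_eq_zero (E := cycleEdges l) (U := U) (V := V) (c := c)
      (z := z + a) (by omega)
    obtain ⟨y, hy, he⟩ := exists_spoke_of_missAt (E := cycleEdges l) (U := U) (V := V) (c := c)
      (z := z) (by omega)
    obtain ⟨x, l', hl', h3, h4, h5⟩ := hR.neg_left.square_two_opt hl (z := z + a) (y := y)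
      (by simpa using hy) (by simpa using he) h1 h2 (by simpa using ha) hqS (by simpa using hsS)
    simp only [add_neg_cancel_right] at hl' h3 h4 h5
    rw [hq', hs'] at hl'
    rw [hq'] at h4
    rw [hs'] at h5
    exact fin l' z y (z + a) x _ _ _ _ hz hp' hl' h3 h4 h5

theorem Rose.cy_singleton [Finite A] (hR : Rose G U V a b c π) {z y : A} {N : List W}
    (hs : Spoke c z y) (hN : RowPath G U V c π z y N) (r : K) (hr : π z = r) :
    Cy G U V π {r} N := by
  obtain ⟨t, ht⟩ := hN.form
  refine ⟨hN.nodup, ?_, fun x => by rw [hN.mem, hr]; simp⟩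
  have := hN.edges
  rw [ht] at this ⊢
  rw [cycleEdges_cons_append, Set.insert_subset_iff]
  exact ⟨hR.adj_spoke hs, this⟩

theorem Grown.single [Fintype A] (hR : Rose G U V a b c π) (hk : 0 < k) :
    Grown G U V c π cell k (· = 0) (fun _ => 0) := by
  obtain ⟨z, hz⟩ := hR.surj (cell 0)
  have hN := hR.rowPath_arc z
  refine ⟨fun i hi => by omega, arc U V c z (addOrderOf c - 1), ?_, ?_⟩
  · convert hR.cy_singleton (Or.inl rfl) hN _ hz using 1
    ext r; simp [eq_comm]
  · rintro i rfl
    obtain ⟨t, ht⟩ := hN.form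
    have e := hN.almostFull (E := cycleEdges (arc U V c z (addOrderOf c - 1))) (by
      rw [ht, cycleEdges_cons_append]; exact Set.subset_insert _ _)
    rw [Nat.le_zero, miss, Finset.sum_eq_zero_iff]
    intro w hw
    have hw : π w = cell 0 := by simpa using hw
    have key : ∀ w', Spoke c w w' → s(U w, V w') ∈ cycleEdges (arc U V c z (addOrderOf c - 1)) := by
      intro w' hs
      by_cases h : s(U w, V w') = s(U z, V z)
      · rw [h, ht, cycleEdges_cons_append]; exact Set.mem_insert _ _
      · exact e w w' (hw.trans hz.symm) hs h
    simp [missAt, key w (Or.inl rfl), key (w + c) (Or.inr rfl)]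

theorem Cy.isHamiltonian [Fintype W] [DecidableEq W] {l : List W} {T : Set K}
    (hR : Rose G U V a b c π) (hl : Cy G U V π T l) (hT : ∀ r, r ∈ T)
    (hUV : ∀ x, ∃ z, x = U z ∨ x = V z) : G.IsHamiltonian := by
  have hm : ∀ x, x ∈ l := by
    intro x
    obtain ⟨z, hz⟩ := hUV x
    exact (hl.mem x).2 ⟨π z, hT _, z, rfl, hz⟩
  refine isHamiltonian_of_list hl.nodup hm ?_ hl.edges
  have h1 : U 0 ≠ U c := hR.injU.ne hR.ne_zero.symm
  have h2 : ({U 0, U c, V 0} : Finset W).card = 3 := by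
    rw [Finset.card_insert_of_notMem, Finset.card_pair (hR.ne _ _)]
    simp [h1, hR.ne]
  rw [← List.toFinset_card_of_nodup hl.nodup, ← h2]
  exact Finset.card_le_card fun x _ => List.mem_toFinset.2 (hm x)

theorem Grown.isHamiltonian [Fintype A] [Fintype W] [DecidableEq W] (hR : Rose G U V a b c π)
    (h : Grown G U V c π cell k S f) (hS : ∀ i < k, S i) (hsurj : ∀ r, ∃ i < k, cell i = r)
    (hUV : ∀ x, ∃ z, x = U z ∨ x = V z) : G.IsHamiltonian := by
  obtain ⟨_, l, hl, _⟩ := h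
  refine hl.isHamiltonian hR (fun r => ?_) hUV
  obtain ⟨i, hi, rfl⟩ := hsurj r
  exact ⟨i, hS i hi, rfl⟩

end Frame

section Schemes
variable {W A K : Type*} [AddCommGroup A] [AddCommGroup K]

/-- An indexing of the rows by `0, …, k - 1` in lines of length `w`. -/
structure Frame (G : SimpleGraph W) (U V : A → W) (a b c : A) (π : A →+ K) (cell : ℕ → K)
    (k w : ℕ) : Prop where
  rose : Rose G U V a b c π
  inj : ∀ i < k, ∀ j < k, cell i = cell j → i = j
  up : ∀ N, N + w < k → cell (N + w) = cell N + π a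
  right : ∀ P x, w ∣ P → x + 1 < w → P + x + 1 < k → cell (P + x + 1) = cell (P + x) + π b
  two_le : 2 ≤ w

variable {G : SimpleGraph W} {U V : A → W} {a b c : A} {π : A →+ K}
  {cell : ℕ → K} {k w : ℕ} {S S' : ℕ → Prop} {f f' : ℕ → ℕ}

theorem Frame.up' (F : Frame G U V a b c π cell k w) {N : ℕ}
    (hb : cell (N + 1) = cell N + π b) (hk : N + w + 1 < k) :
    cell (N + w + 1) = cell N + π a + π b := by
  rw [add_right_comm, F.up (N + 1) (by omega), hb, add_right_comm]

variable [Fintype A]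

theorem Frame.insert (F : Frame G U V a b c π cell k w) (h : Grown G U V c π cell k S f) (N : ℕ)
    (hb : cell (N + 1) = cell N + π b) (hk : N + w + 1 < k)
    (hr : S N) (hfr : f N ≤ 3) (h₀ : ¬ S (N + 1) ∧ ¬ S (N + w) ∧ ¬ S (N + w + 1))
    (hS : ∀ i, S' i ↔ i = N + 1 ∨ i = N + w ∨ i = N + w + 1 ∨ S i)
    (hf : f N + 1 ≤ f' N ∧ 1 ≤ f' (N + 1) ∧ 1 ≤ f' (N + w) ∧ 1 ≤ f' (N + w + 1))
    (hf' : ∀ i, S i → i ≠ N → f i ≤ f' i) : Grown G U V c π cell k S' f' := by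
  have hw := F.two_le
  refine h.insert F.rose F.inj (F.up N (by omega)) (F.up' hb hk) hb hr hfr h₀.2.1 h₀.2.2 h₀.1
    ⟨by omega, hk, by omega⟩ (by omega) (fun i => ?_) ?_ hf'
  · rw [hS]; tauto
  · tauto

theorem Frame.insert_right (F : Frame G U V a b c π cell k w) (h : Grown G U V c π cell k S f)
    (N : ℕ) (hb : cell (N + 1) = cell N + π b) (hk : N + w + 1 < k)
    (hr : S (N + 1)) (hfr : f (N + 1) ≤ 3) (h₀ : ¬ S N ∧ ¬ S (N + w) ∧ ¬ S (N + w + 1))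
    (hS : ∀ i, S' i ↔ i = N ∨ i = N + w ∨ i = N + w + 1 ∨ S i)
    (hf : f (N + 1) + 1 ≤ f' (N + 1) ∧ 1 ≤ f' N ∧ 1 ≤ f' (N + w) ∧ 1 ≤ f' (N + w + 1))
    (hf' : ∀ i, S i → i ≠ N + 1 → f i ≤ f' i) : Grown G U V c π cell k S' f' := by
  have hw := F.two_le
  refine h.insert (r := N + 1) (p := N + w + 1) (q := N + w) (s := N) F.rose.neg_right F.inj
    ?_ ?_ ?_ hr hfr h₀.2.2 h₀.2.1 h₀.1 ⟨by omega, by omega, by omega⟩ (by omega)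
    (fun i => ?_) ?_ hf'
  · rw [F.up' hb hk, hb]; abel
  · rw [F.up N (by omega), hb, map_neg]; abel
  · rw [hb, map_neg]; abel
  · rw [hS]; tauto
  · tauto

theorem Frame.insert_up (F : Frame G U V a b c π cell k w) (h : Grown G U V c π cell k S f)
    (N : ℕ) (hb : cell (N + 1) = cell N + π b) (hk : N + w + 1 < k)
    (hr : S (N + w)) (hfr : f (N + w) ≤ 3) (h₀ : ¬ S N ∧ ¬ S (N + 1) ∧ ¬ S (N + w + 1))
    (hS : ∀ i, S' i ↔ i = N ∨ i = N + 1 ∨ i = N + w + 1 ∨ S i)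
    (hf : f (N + w) + 1 ≤ f' (N + w) ∧ 1 ≤ f' N ∧ 1 ≤ f' (N + 1) ∧ 1 ≤ f' (N + w + 1))
    (hf' : ∀ i, S i → i ≠ N + w → f i ≤ f' i) : Grown G U V c π cell k S' f' := by
  have hw := F.two_le
  refine h.insert (r := N + w) (p := N) (q := N + 1) (s := N + w + 1) F.rose.neg_left F.inj
    ?_ ?_ ?_ hr hfr h₀.1 h₀.2.1 h₀.2.2 ⟨by omega, by omega, by omega⟩ (by omega)
    (fun i => ?_) ?_ hf'
  · rw [F.up N (by omega), map_neg]; abel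
  · rw [F.up N (by omega), hb, map_neg]; abel
  · rw [F.up' hb hk, F.up N (by omega)]
  · rw [hS]
  · tauto

theorem Frame.extend_right (F : Frame G U V a b c π cell k w) (h : Grown G U V c π cell k S f)
    (N : ℕ) (hb : cell (N + 1) = cell N + π b) (hk : N + w + 1 < k)
    (hr : S N ∧ S (N + w)) (hfr : f N + f (N + w) ≤ 3) (h₀ : ¬ S (N + 1) ∧ ¬ S (N + w + 1))
    (hS : ∀ i, S' i ↔ i = N + 1 ∨ i = N + w + 1 ∨ S i)
    (hf : f N + 1 ≤ f' N ∧ f (N + w) + 1 ≤ f' (N + w) ∧ 1 ≤ f' (N + 1) ∧ 1 ≤ f' (N + w + 1))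
    (hf' : ∀ i, S i → i ≠ N → i ≠ N + w → f i ≤ f' i) : Grown G U V c π cell k S' f' := by
  have hw := F.two_le
  refine h.extend F.rose F.inj (F.up N (by omega)) (F.up' hb hk) hb hr.1 hr.2 hfr (by omega) h₀.2
    h₀.1 ⟨by omega, by omega⟩ (fun i => ?_) ?_ hf'
  · rw [hS]; tauto
  · tauto

theorem Frame.extend_up (F : Frame G U V a b c π cell k w) (h : Grown G U V c π cell k S f)
    (N : ℕ) (hb : cell (N + 1) = cell N + π b) (hk : N + w + 1 < k)
    (hr : S N ∧ S (N + 1)) (hfr : f N + f (N + 1) ≤ 3) (h₀ : ¬ S (N + w) ∧ ¬ S (N + w + 1))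
    (hS : ∀ i, S' i ↔ i = N + w ∨ i = N + w + 1 ∨ S i)
    (hf : f N + 1 ≤ f' N ∧ f (N + 1) + 1 ≤ f' (N + 1) ∧ 1 ≤ f' (N + w) ∧ 1 ≤ f' (N + w + 1))
    (hf' : ∀ i, S i → i ≠ N → i ≠ N + 1 → f i ≤ f' i) : Grown G U V c π cell k S' f' := by
  have hw := F.two_le
  refine Grown.of_dual F.rose ((h.dual F.rose).extend (p := N + 1) (q := N + w + 1) (s := N + w)
    F.rose.dual F.inj hb ?_ (F.up N (by omega)) hr.1 hr.2 hfr (by omega) h₀.2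
    h₀.1 ⟨by omega, by omega⟩ (fun i => ?_) ?_ hf')
  · rw [F.up' hb hk]; abel
  · rw [hS]; tauto
  · tauto

theorem Frame.strip_of_lt (F : Frame G U V a b c π cell k w) (h : Grown G U V c π cell k S f)
    {P x y : ℕ} (hP : w ∣ P) (hxy : x + 1 ≤ y) (hy : y < w) (hk : P + w + y < k)
    (hr : S (P + x) ∧ S (P + w + x)) (hfr : f (P + x) + f (P + w + x) ≤ 3)
    (h₀ : ∀ i, x < i → i ≤ y → ¬ S (P + i) ∧ ¬ S (P + w + i)) :
    Grown G U V c π cell k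
      (fun i => S i ∨ (P + x < i ∧ i ≤ P + y) ∨ (P + w + x < i ∧ i ≤ P + w + y))
      (fun i => if i = P + x ∨ i = P + w + x then f i + 1 else
        if (P + x < i ∧ i < P + y) ∨ (P + w + x < i ∧ i < P + w + y) then 2 else
        if i = P + y ∨ i = P + w + y then 1 else f i) := by
  have hw := F.two_le
  induction y, hxy using Nat.le_induction with
  | base =>
    have hn := h₀ (x + 1) (by omega) le_rfl
    refine F.extend_right h (P + x) (F.right P x hP hy (by omega)) (by omega) ?_ ?_ ?_
      (fun i => ?_) ?_ ?_
    · rwa [add_right_comm P x w]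
    · rwa [add_right_comm P x w]
    · rwa [add_right_comm P x w]
    · have : (P + x < i ∧ i ≤ P + (x + 1)) ↔ i = P + x + 1 := by omega
      have : (P + w + x < i ∧ i ≤ P + w + (x + 1)) ↔ i = P + x + w + 1 := by omega
      tauto
    · refine ⟨?_, ?_, ?_, ?_⟩ <;> split_ifs <;> omega
    · intro i hi h1 h2
      have : i ≠ P + (x + 1) := fun e => hn.1 (e ▸ hi)
      have : i ≠ P + w + (x + 1) := fun e => hn.2 (e ▸ hi)
      split_ifs <;> omega
  | succ y hxy ih =>
    have ih := ih (by omega) (by omega) (fun i h1 h2 => h₀ i h1 (by omega))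
    have hn := h₀ (y + 1) (by omega) le_rfl
    refine F.extend_right ih (P + y) (F.right P y hP hy (by omega)) (by omega) ?_ ?_ ?_
      (fun i => ?_) ?_ ?_
    · exact ⟨Or.inr (by omega), Or.inr (by omega)⟩
    · split_ifs <;> omega
    · rw [show P + y + w + 1 = P + w + (y + 1) by omega, show P + y + 1 = P + (y + 1) by omega]
      simp only [hn, false_or]
      omega
    · by_cases hS : S i
      · simp [hS]
      · simp only [hS, false_or]
        omega
    · refine ⟨?_, ?_, ?_, ?_⟩ <;> split_ifs <;> omega
    · intro i hi h1 h2
      rcases hi with hi | hi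
      · have : i ≠ P + (y + 1) := fun e => hn.1 (e ▸ hi)
        have : i ≠ P + w + (y + 1) := fun e => hn.2 (e ▸ hi)
        split_ifs <;> omega
      · split_ifs <;> omega

theorem Frame.strip (F : Frame G U V a b c π cell k w) (h : Grown G U V c π cell k S f)
    {P x y : ℕ} (hP : w ∣ P) (hxy : x ≤ y) (hy : y < w) (hk : P + w + y < k)
    (hr : S (P + x) ∧ S (P + w + x)) (hfr : f (P + x) + f (P + w + x) ≤ 3)
    (h₀ : ∀ i, x < i → i ≤ y → ¬ S (P + i) ∧ ¬ S (P + w + i))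
    (hS : ∀ i, S' i ↔ S i ∨ (P + x < i ∧ i ≤ P + y) ∨ (P + w + x < i ∧ i ≤ P + w + y))
    (hf : ∀ i, S' i → (i = P + x ∨ i = P + w + x → f i + 1 ≤ f' i) ∧
      ((P + x < i ∧ i < P + y) ∨ (P + w + x < i ∧ i < P + w + y) → 2 ≤ f' i) ∧
      (i = P + y ∨ i = P + w + y → 1 ≤ f' i) ∧ (S i → f i ≤ f' i)) :
    Grown G U V c π cell k S' f' := by
  rcases Nat.eq_or_lt_of_le hxy with rfl | hlt
  · refine h.mono (fun i => (hS i).trans ?_) (fun i hi => (hf i ((hS i).2 (Or.inl hi))).2.2.2 hi)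
    constructor
    · rintro (h | h | h)
      · exact h
      · omega
      · omega
    · exact Or.inl
  · refine (F.strip_of_lt h hP hlt hy hk hr hfr h₀).mono hS (fun i hi => ?_)
    obtain ⟨h1, h2, h3, h4⟩ := hf i ((hS i).2 hi)
    split_ifs with i1 i2 i3
    · exact h1 i1
    · exact h2 i2
    · exact h3 i3
    · refine h4 (hi.resolve_right ?_)
      omega

end Schemes

section Indices
variable {W A K : Type*} [AddCommGroup A] [AddCommGroup K]
  {G : SimpleGraph W} {U V : A → W} {a b c : A} {π : A →+ K}
  {cell : ℕ → K} {k w : ℕ} {S S' : ℕ → Prop} {f f' : ℕ → ℕ} [Fintype A]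

/-- A cycle through the rows `0, …, x` and `w, …, w + x` and `lo, …, 2 * w + x - 1`. -/
def Staircase (G : SimpleGraph W) (U V : A → W) (c : A) (π : A →+ K) (cell : ℕ → K)
    (k w lo x : ℕ) : Prop :=
  Grown G U V c π cell k (fun i => i ≤ x ∨ (w ≤ i ∧ i ≤ w + x) ∨ (lo ≤ i ∧ i < 2 * w + x))
    (fun i => if i = x ∨ i = w + x ∨ 2 * w ≤ i then 1 else 3)

theorem Frame.staircase_step (F : Frame G U V a b c π cell k w) {lo x : ℕ}
    (h : Staircase G U V c π cell k w lo x) (h1 : 2 * w ≤ lo) (h2 : lo ≤ 2 * w + x)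
    (hx : x + 2 < w) (hk : 2 * w + x + 1 < k) : Staircase G U V c π cell k w lo (x + 2) := by
  have hs := F.insert (S' := fun i => (i ≤ x ∨ (w ≤ i ∧ i ≤ w + x + 1) ∨
      (lo ≤ i ∧ i < 2 * w + x + 2)))
    (f' := fun i => if i = w + x then 2 else if i = w + x + 1 ∨ 2 * w ≤ i then 1 else 3) h (w + x)
    (F.right w x dvd_rfl (by omega) (by omega)) (by omega) (by omega) (by split_ifs <;> omega)
    (by omega) (fun i => by omega) (by split_ifs <;> omega)
    (fun i hi h1 => by split_ifs <;> omega)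
  exact F.insert_up hs (x + 1)
    (by simpa using F.right 0 (x + 1) (dvd_zero _) (by omega) (by omega))
    (by omega) (by omega) (by split_ifs <;> omega)
    (by omega) (fun i => by omega) (by split_ifs <;> omega)
    (fun i hi h1 => by split_ifs <;> omega)

theorem Frame.staircase_run (F : Frame G U V a b c π cell k w) {lo x : ℕ}
    (h : Staircase G U V c π cell k w lo x) (h1 : 2 * w ≤ lo) (h2 : lo ≤ 2 * w + x) (j : ℕ)
    (hx : x + 2 * j < w) (hk : 2 * w + x + 2 * j ≤ k) :
    Staircase G U V c π cell k w lo (x + 2 * j) := by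
  induction j with
  | zero => exact h
  | succ j ih =>
    rw [show x + 2 * (j + 1) = x + 2 * j + 2 by ring]
    exact F.staircase_step (ih (by omega) (by omega)) h1 (by omega) (by omega) (by omega)

/-- A cycle through the rows `0, …, M - 1`, ready to be extended by the rows `M` and `M + 1`. -/
def Block (G : SimpleGraph W) (U V : A → W) (c : A) (π : A →+ K) (cell : ℕ → K)
    (k w M : ℕ) : Prop :=
  Grown G U V c π cell k (fun i => i < M)
    (fun i => if M < i + w then 1 else if M = i + w then 2 else 4)

theorem Frame.block_step (F : Frame G U V a b c π cell k w) {N : ℕ}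
    (hb : cell (N + 1) = cell N + π b)
    (h : Block G U V c π cell k w (N + w)) (hk : N + w + 2 ≤ k) :
    Block G U V c π cell k w (N + w + 2) := by
  have hw := F.two_le
  refine F.extend_up h N hb (by omega) (by omega) ?_ (by omega) (fun i => by omega) ?_ ?_
  · split_ifs <;> omega
  · refine ⟨?_, ?_, ?_, ?_⟩ <;> split_ifs <;> omega
  · intro i hi h1 h2
    split_ifs <;> omega

theorem Frame.block_run (F : Frame G U V a b c π cell k w)
    (hb : ∀ N, cell (N + 1) = cell N + π b) {M : ℕ} (hM : w ≤ M)
    (h : Block G U V c π cell k w M) (j : ℕ) (hk : M + 2 * j ≤ k) :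
    Block G U V c π cell k w (M + 2 * j) := by
  induction j with
  | zero => exact h
  | succ j ih =>
    rw [show M + 2 * (j + 1) = M + 2 * j + 2 by ring]
    obtain ⟨N, hN⟩ := Nat.exists_eq_add_of_le' (show w ≤ M + 2 * j by omega)
    have ih := ih (by omega)
    rw [hN] at ih ⊢
    exact F.block_step (hb N) ih (by omega)

theorem Frame.block_grown (F : Frame G U V a b c π cell k w)
    (hb : ∀ N, cell (N + 1) = cell N + π b) {M : ℕ} (hM : w ≤ M)
    (h : Block G U V c π cell k w M) (hk : M ≤ k) (he : Even (k - M)) :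
    ∃ f, Grown G U V c π cell k (fun i => i < k) f := by
  obtain ⟨j, hj⟩ := he
  have := F.block_run hb hM h j (by omega)
  rw [show M + 2 * j = k by omega] at this
  exact ⟨_, this⟩

/-- The square of the rows `0`, `1`, `w`, `w + 1`. -/
theorem Frame.square (F : Frame G U V a b c π cell k w) (hk : w + 1 < k) :
    Grown G U V c π cell k (fun i => i ≤ 1 ∨ i = w ∨ i = w + 1) (fun _ => 1) := by
  have hw := F.two_le
  exact F.insert (Grown.single F.rose (by omega)) 0
    (by simpa using F.right 0 0 (dvd_zero _) (by omega) (by omega)) (by omega) rfl (by omega)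
    (by omega) (fun i => by omega) (by omega) (fun i hi h1 => by omega)

theorem Frame.staircase_one (F : Frame G U V a b c π cell k w) (hk : w + 1 < k) :
    Staircase G U V c π cell k w (2 * w + 1) 1 :=
  have hw := F.two_le
  (F.square hk).mono (fun i => by omega) (fun i hi => by split_ifs <;> omega)

theorem Frame.staircase_two (F : Frame G U V a b c π cell k w)
    (h : Grown G U V c π cell k
      (fun i => i ≤ 1 ∨ i = w ∨ i = w + 1 ∨ i = 2 * w ∨ i = 2 * w + 1)
      (fun i => if i = w ∨ i = w + 1 then 2 else 1)) (hw : 3 ≤ w) (hk : 2 * w + 1 < k) :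
    Staircase G U V c π cell k w (2 * w) 2 :=
  F.extend_right h 1
    (by simpa using F.right 0 1 (dvd_zero _) (by omega) (by omega))
    (by omega) (by omega) (by split_ifs <;> omega)
    (by omega) (fun i => by omega) (by split_ifs <;> omega)
    (fun i hi h1 h2 => by split_ifs <;> omega)

theorem Frame.square_up (F : Frame G U V a b c π cell k w) (hk : 2 * w + 1 < k)
    (hb : cell (w + 1) = cell w + π b) : Grown G U V c π cell k
      (fun i => i ≤ 1 ∨ i = w ∨ i = w + 1 ∨ i = 2 * w ∨ i = 2 * w + 1)
      (fun i => if i = w ∨ i = w + 1 then 2 else 1) := by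
  have hw := F.two_le
  exact F.extend_up (F.square (by omega)) w hb (by omega) (by omega) (by omega)
    (by omega) (fun i => by omega) (by split_ifs <;> omega)
    (fun i hi h1 h2 => by split_ifs <;> omega)

end Indices

section Helix
variable {W A K : Type*} [AddCommGroup A] [AddCommGroup K]
  {G : SimpleGraph W} {U V : A → W} {a b c : A} {π : A →+ K}
  {cell : ℕ → K} {k w : ℕ} [Fintype A]

theorem Frame.fill_even (F : Frame G U V a b c π cell k w) {x : ℕ}
    (h : Staircase G U V c π cell k w (2 * w) x) (hx : 1 ≤ x) (hxw : x < w) (hk : 2 * w + x ≤ k) :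
    Grown G U V c π cell k (fun i => i < 2 * w + x) (fun i => if i < w + x then 4 else
      if w + x < i ∧ i < 2 * w - 1 then 2 else if i = w + x then 2 else 1) := by
  refine F.strip h (P := 0) (x := x) (y := w - 1) (dvd_zero _) (by omega) (by omega) (by omega)
    (by omega) ?_ (fun i h1 h2 => by omega) (fun i => by omega) (fun i hi => ?_)
  · split_ifs <;> omega
  · split_ifs <;> omega

theorem Frame.fill_odd (F : Frame G U V a b c π cell k w)
    (hb : ∀ N, cell (N + 1) = cell N + π b) {x : ℕ}
    (h : Staircase G U V c π cell k w (2 * w + 1) x) (hx : 1 ≤ x) (hxw : x + 1 < w)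
    (hk : 2 * w + x ≤ k) :
    Grown G U V c π cell k (fun i => i < 2 * w + x) (fun i => if i < w + x then 4 else
      if w + x < i ∧ i < 2 * w - 2 then 2 else if i = w + x then 2 else 1) := by
  have h' := F.strip (S' := fun i => i + 2 ≤ w ∨ (w ≤ i ∧ i + 2 ≤ 2 * w) ∨
      (2 * w + 1 ≤ i ∧ i < 2 * w + x))
    (f' := fun i => if i = w then 3 else if i < w + x then 4 else
      if w + x < i ∧ i < 2 * w - 2 then 2 else if i = w + x then 2 else 1) h
    (P := 0) (x := x) (y := w - 2) (dvd_zero _) (by omega) (by omega) (by omega)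
    (by omega) (by split_ifs <;> omega) (fun i h1 h2 => by omega) (fun i => by omega)
    (fun i hi => by split_ifs <;> omega)
  refine F.insert_right h' (w - 1) (hb _) (by omega) (by omega) ?_ (by omega) (fun i => by omega)
    ?_ (fun i hi h1 => ?_)
  · split_ifs <;> omega
  · refine ⟨?_, ?_, ?_, ?_⟩ <;> split_ifs <;> omega
  · split_ifs <;> omega

theorem Frame.helix_even (F : Frame G U V a b c π cell k w)
    (hb : ∀ N, cell (N + 1) = cell N + π b) (hk : 2 * w + 2 ≤ k) (he : Even k) :
    ∃ f, Grown G U V c π cell k (fun i => i < k) f := by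
  have hw := F.two_le
  obtain ⟨q, rfl⟩ := he
  rcases hw.eq_or_lt with rfl | hw3
  · refine F.block_grown hb (M := 4) (by omega) ((F.square (by omega)).mono (fun i => by omega)
      (fun i hi => by split_ifs <;> omega)) (by omega) ⟨q - 2, by omega⟩
  have h := F.staircase_two (F.square_up (by omega) (hb _)) hw3 (by omega)
  by_cases hc : 2 * w + (w - 2) ≤ q + q
  · obtain ⟨j, hj, hj'⟩ : ∃ j, 2 + 2 * j < w ∧ w ≤ 2 + 2 * j + 2 :=
      ⟨(w - 3) / 2, by omega, by omega⟩
    have h' := F.fill_even (F.staircase_run h (by omega) (by omega) j hj (by omega))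
      (by omega) hj (by omega)
    refine F.block_grown hb (M := 2 * w + (2 + 2 * j)) (by omega) (h'.mono (fun i => by omega)
      (fun i hi => by split_ifs <;> omega)) (by omega) ⟨q - w - 1 - j, by omega⟩
  · obtain ⟨j, hj⟩ : ∃ j, 2 * w + (2 + 2 * j) = q + q := ⟨q - w - 1, by omega⟩
    have h' := F.fill_even (F.staircase_run h (by omega) (by omega) j (by omega) (by omega))
      (by omega) (by omega) (by omega)
    rw [hj] at h'
    exact ⟨_, h'⟩

theorem Frame.helix_odd (F : Frame G U V a b c π cell k w)
    (hb : ∀ N, cell (N + 1) = cell N + π b) (hk : 2 * w + 1 ≤ k) (ho : Odd k)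
    (h5 : ¬ (k = 5 ∧ w = 2)) : ∃ f, Grown G U V c π cell k (fun i => i < k) f := by
  have hw := F.two_le
  obtain ⟨q, rfl⟩ := ho
  rcases hw.eq_or_lt with rfl | hw3
  · have h := F.insert (S' := fun i => i < 7)
      (f' := fun i => if 7 < i + 2 then 1 else if 7 = i + 2 then 2 else 4)
      (F.square (by omega)) 3 (hb 3) (by omega) (by omega) (by omega) (by omega)
      (fun i => by omega) (by norm_num) (fun i hi h1 => by split_ifs <;> omega)
    exact F.block_grown hb (M := 7) (by omega) h (by omega) ⟨q - 3, by omega⟩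
  have h := F.staircase_one (by omega)
  by_cases hc : 2 * w + (w - 2) ≤ 2 * q + 1
  · obtain ⟨j, hj, hj'⟩ : ∃ j, 1 + 2 * j + 1 < w ∧ w ≤ 1 + 2 * j + 3 :=
      ⟨(w - 3) / 2, by omega, by omega⟩
    have h' := F.fill_odd hb (F.staircase_run h (by omega) (by omega) j (by omega) (by omega))
      (by omega) hj (by omega)
    refine F.block_grown hb (M := 2 * w + (1 + 2 * j)) (by omega) (h'.mono (fun i => by omega)
      (fun i hi => by split_ifs <;> omega)) (by omega) ⟨q - w - j, by omega⟩
  · obtain ⟨j, hj⟩ : ∃ j, 2 * w + (1 + 2 * j) = 2 * q + 1 := ⟨q - w, by omega⟩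
    have h' := F.fill_odd hb (F.staircase_run h (by omega) (by omega) j (by omega) (by omega))
      (by omega) (by omega) (by omega)
    rw [hj] at h'
    exact ⟨_, h'⟩

theorem Frame.helix (F : Frame G U V a b c π cell k w)
    (hb : ∀ N, cell (N + 1) = cell N + π b) (hk : 2 * w ≤ k)
    (h5 : ¬ (k = 5 ∧ w = 2)) : ∃ f, Grown G U V c π cell k (fun i => i < k) f := by
  have hw := F.two_le
  rcases Nat.even_or_odd k with he | ho
  · rcases hk.eq_or_lt with rfl | hlt
    · exact ⟨fun _ => 4, F.strip (F.square (by omega)) (P := 0) (x := 1) (y := w - 1) (dvd_zero _)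
        (by omega) (by omega) (by omega) (by omega) (by omega) (fun i h1 h2 => by omega)
        (fun i => by omega) (fun i hi => by omega)⟩
    · exact F.helix_even hb (by obtain ⟨q, rfl⟩ := he; omega) he
  · exact F.helix_odd hb (by obtain ⟨q, rfl⟩ := ho; omega) ho h5

end Helix

section Grid
variable {W A K : Type*} [AddCommGroup A] [AddCommGroup K]
  {G : SimpleGraph W} {U V : A → W} {a b c : A} {π : A →+ K}
  {cell : ℕ → K} {k w : ℕ} [Fintype A]

/-- A cycle through the rows `0, …, P + w - 1`, ready to be extended by two more lines. -/
def Stack (G : SimpleGraph W) (U V : A → W) (c : A) (π : A →+ K) (cell : ℕ → K)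
    (k w P : ℕ) : Prop :=
  Grown G U V c π cell k (fun i => i < P + w)
    (fun i => if i = P then 1 else if i = P + 1 then 2 else 4)

theorem Frame.stack_step (F : Frame G U V a b c π cell k w) {P : ℕ} (hP : w ∣ P)
    (h : Stack G U V c π cell k w P) (hk : P + 2 * w + w ≤ k) :
    Stack G U V c π cell k w (P + 2 * w) := by
  have hw := F.two_le
  have hPw : w ∣ P + w := (Nat.dvd_add_right hP).2 dvd_rfl
  have h1 := F.extend_up (S' := fun i => i < P + w + 2) (f' := fun i => if P + w ≤ i then 1 else 4)
    h P (F.right P 0 hP (by omega) (by omega)) (by omega) (by omega) (by split_ifs <;> omega)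
    (by omega) (fun i => by omega) (by split_ifs <;> omega) (fun i hi h1 h2 => by split_ifs <;> omega)
  have h2 := F.extend_up (S' := fun i => i < P + w + 2 ∨ i = P + w + w ∨ i = P + w + w + 1)
    (f' := fun i => if P + w + w ≤ i then 1 else if P + w ≤ i then 2 else 4)
    h1 (P + w) (F.right (P + w) 0 hPw (by omega) (by omega)) (by omega) (by omega)
    (by split_ifs <;> omega)
    (by omega) (fun i => by omega) (by split_ifs <;> omega) (fun i hi h1 h2 => by split_ifs <;> omega)
  exact F.strip h2 (P := P + w) (x := 1) (y := w - 1) hPw (by omega) (by omega) (by omega)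
    (by omega) (by split_ifs <;> omega) (fun i h1 h2 => by omega) (fun i => by omega)
    (fun i hi => by split_ifs <;> omega)

theorem Frame.stack_grown (F : Frame G U V a b c π cell k w) {P : ℕ} (hP : w ∣ P)
    (h : Stack G U V c π cell k w P) (j : ℕ) (hk : k = P + w + 2 * w * j) :
    ∃ f, Grown G U V c π cell k (fun i => i < k) f := by
  induction j generalizing P with
  | zero => exact ⟨_, h.mono (fun i => by rw [hk]; rfl) (fun _ _ => le_rfl)⟩
  | succ j ih =>
    rw [show P + w + 2 * w * (j + 1) = P + 2 * w + w + 2 * w * j by ring] at hk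
    exact ih ((Nat.dvd_add_right hP).2 (Dvd.intro_left 2 rfl))
      (F.stack_step hP h (by rw [hk]; exact Nat.le_add_right _ _)) hk

theorem Frame.stack_even (F : Frame G U V a b c π cell k w) (hk : 3 * w ≤ k) (he : Even w) :
    Stack G U V c π cell k w (2 * w) := by
  obtain ⟨q, hq⟩ := he
  have hw := F.two_le
  rcases hw.eq_or_lt with rfl | hw3
  · exact F.extend_up (F.square (by omega)) 2 (F.right 2 0 dvd_rfl (by omega) (by omega))
      (by omega) (by omega) (by omega) (by omega) (fun i => by omega) (by norm_num)
      (fun i hi h1 h2 => by split_ifs <;> omega)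
  have h := F.staircase_two
    (F.square_up (by omega) (F.right w 0 dvd_rfl (by omega) (by omega))) hw3 (by omega)
  have h := F.staircase_run h le_rfl (by omega) (q - 2) (by omega) (by omega)
  rw [show 2 + 2 * (q - 2) = w - 2 by omega] at h
  have h := F.fill_even h (by omega) (by omega) (by omega)
  refine F.extend_up h (2 * w - 2) ?_
    (by omega) (by omega) (by split_ifs <;> omega) (by omega) (fun i => by omega) ?_
    (fun i hi h1 h2 => by split_ifs <;> omega)
  · convert F.right w (w - 2) dvd_rfl (by omega) (by omega) using 2 <;> congr 1 <;> omega
  · refine ⟨?_, ?_, ?_, ?_⟩ <;> split_ifs <;> omega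

theorem Frame.stack_odd (F : Frame G U V a b c π cell k w) (hk : 5 * w ≤ k) (ho : Odd w) :
    Stack G U V c π cell k w (4 * w) := by
  obtain ⟨q, hq⟩ := ho
  have hw := F.two_le
  have h := F.staircase_run (F.staircase_one (by omega)) (by omega) (by omega) (q - 1)
    (by omega) (by omega)
  rw [show 1 + 2 * (q - 1) = w - 2 by omega] at h
  have h1 := F.strip (S' := fun i => i < 2 * w ∨ (2 * w < i ∧ i + 2 < 3 * w))
    (f' := fun i => if i = 2 * w - 2 then 2 else if 2 * w - 1 ≤ i then 1 else 4) h
    (P := 0) (x := w - 2) (y := w - 1) (dvd_zero _) (by omega) (by omega) (by omega)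
    (by omega) (by split_ifs <;> omega) (fun i h1 h2 => by omega) (fun i => by omega)
    (fun i hi => by split_ifs <;> omega)
  have h2 := F.extend_up (S' := fun i => i < 3 * w ∧ i ≠ 2 * w)
    (f' := fun i => if 2 * w < i then 1 else 4) h1 (2 * w - 2)
    (by convert F.right w (w - 2) dvd_rfl (by omega) (by omega) using 2 <;> congr 1 <;> omega)
    (by omega) (by omega) (by split_ifs <;> omega) (by omega) (fun i => by omega)
    (by refine ⟨?_, ?_, ?_, ?_⟩ <;> split_ifs <;> omega)
    (fun i hi h1 h2 => by split_ifs <;> omega)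
  have h3 := F.insert_right (S' := fun i => i < 3 * w + 2)
    (f' := fun i => if 3 * w ≤ i then 1 else 4) h2 (2 * w)
    (F.right (2 * w) 0 (Dvd.intro_left 2 rfl) (by omega) (by omega))
    (by omega) (by omega) (by split_ifs <;> omega) (by omega) (fun i => by omega)
    (by split_ifs <;> omega) (fun i hi h1 => by split_ifs <;> omega)
  have h4 := F.extend_up (S' := fun i => i < 3 * w + 2 ∨ i = 4 * w ∨ i = 4 * w + 1)
    (f' := fun i => if 4 * w ≤ i then 1 else if 3 * w ≤ i then 2 else 4) h3 (3 * w)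
    (F.right (3 * w) 0 (Dvd.intro_left 3 rfl) (by omega) (by omega))
    (by omega) (by omega) (by split_ifs <;> omega) (by omega) (fun i => by omega)
    (by split_ifs <;> omega) (fun i hi h1 h2 => by split_ifs <;> omega)
  exact F.strip h4 (P := 3 * w) (x := 1) (y := w - 1) (Dvd.intro_left 3 rfl) (by omega) (by omega)
    (by omega) (by omega) (by split_ifs <;> omega) (fun i h1 h2 => by omega) (fun i => by omega)
    (fun i hi => by split_ifs <;> omega)

theorem Frame.grid (F : Frame G U V a b c π cell k w) {s : ℕ} (hk : k = s * w) (hs : Odd s)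
    (h3 : 3 ≤ s) (h5 : Odd w → 5 ≤ s) : ∃ f, Grown G U V c π cell k (fun i => i < k) f := by
  obtain ⟨q, rfl⟩ := hs
  rcases Nat.even_or_odd w with he | ho
  · obtain ⟨j, rfl⟩ := Nat.exists_eq_add_of_le' (show 1 ≤ q by omega)
    have e : k = 2 * w + w + 2 * w * j := by rw [hk]; ring
    exact F.stack_grown (Dvd.intro_left 2 rfl) (F.stack_even (by omega) he) j e
  · obtain ⟨j, rfl⟩ := Nat.exists_eq_add_of_le' (show 2 ≤ q by have := h5 ho; omega)
    have e : k = 4 * w + w + 2 * w * j := by rw [hk]; ring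
    exact F.stack_grown (Dvd.intro_left 4 rfl) (F.stack_odd (by omega) ho) j e

end Grid

section Fiber
variable {W A K : Type*} [AddCommGroup A] [AddCommGroup K]
  {G : SimpleGraph W} {U V : A → W} {a b c : A} {π : A →+ K} {S : Set K}

theorem arc_succ_eq (x : A) (s : ℕ) : ∃ T, arc U V c x (s + 1) =
    U x :: V (x + c) :: T ++ [U (x + (s + 1) • c), V (x + (s + 1) • c + c)] := by
  have h : ∃ T, arc U V c x s = U x :: V (x + c) :: T := by
    cases s with
    | zero => exact ⟨[], rfl⟩
    | succ s => exact ⟨_, rfl⟩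
  obtain ⟨T, hT⟩ := h
  refine ⟨T, ?_⟩
  have := arc_append (U := U) (V := V) (c := c) x s 0
  rw [hT] at this
  exact this

theorem exists_arc_prefix (x : A) {i j : ℕ} (h : i ≤ j) :
    ∃ D, arc U V c x j = arc U V c x i ++ D := by
  rcases h.eq_or_lt with rfl | h
  · exact ⟨[], by simp⟩
  · obtain ⟨d, rfl⟩ := Nat.exists_eq_add_of_lt h
    exact ⟨_, arc_append x i d⟩

theorem Rose.fiber_step [Finite A] (hR : Rose G U V a b c π) {t : ℕ} (hb : b = t • c) (ht : 0 < t)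
    (hn : 2 * t + 1 ≤ addOrderOf c) {y : A} {D : List W} (hl : Cy G U V π S (arc U V c y t ++ D))
    (hS : π y + π a ∉ S) :
    ∃ D', Cy G (fun z => U (-z)) (fun z => V (c - z)) (-π) ({π y + π a} ∪ S)
      (arc (fun z => U (-z)) (fun z => V (c - z)) c (-(y + a)) t ++ D') := by
  classical
  obtain ⟨s, rfl⟩ : ∃ s, t = s + 1 := ⟨t - 1, by omega⟩
  obtain ⟨d, hd⟩ := Nat.exists_eq_add_of_le hn
  set n := addOrderOf c with hn'
  set x := y + a with hx
  set U' : A → W := fun z => U (-z) with hU'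
  set V' : A → W := fun z => V (c - z) with hV'
  have hR' := hR.reflect
  have hN := hR'.rowPath_arc (-x)
  rw [← hn', show n - 1 = (s + 1 + d) + s + 1 by omega, arc_append] at hN
  obtain ⟨D₁, hD₁⟩ := exists_arc_prefix (U := U') (V := V') (c := c) (-x)
    (show s + 1 ≤ s + 1 + d by omega)
  obtain ⟨R, hRe⟩ := arc_eq (U := U') (V := V') (c := c) (-x) (s + 1 + d)
  have hnc : n • c = 0 := addOrderOf_nsmul_eq_zero c
  have e1 : (s + 1 + d + 1) • c = -((s + 1) • c) := by
    rw [eq_neg_iff_add_eq_zero, ← add_smul, ← hnc]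
    congr 1; omega
  rw [e1] at hN hRe
  obtain ⟨Q, hQ⟩ := arc_eq (U := U') (V := V') (c := c) (-x + -((s + 1) • c)) s
  obtain ⟨T, hT⟩ := arc_succ_eq (U := U) (V := V) (c := c) y s
  set e := y + (s + 1) • c with he
  have e2 : U' (-x) = U x := by simp [hU']
  have e3 : V' (-x + -((s + 1) • c)) = V (e + a + c) := by
    simp only [hV']; congr 1; rw [he, hx]; abel
  have e4 : U' (-x + -((s + 1) • c)) = U (e + a) := by
    simp only [hU']; congr 1; rw [he, hx]; abel
  have e5 : V' (-x + -((s + 1) • c) + (s + 1) • c) = V (x + c) := by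
    simp only [hV']; congr 1; abel
  rw [e2, e3] at hRe
  rw [e4, e5] at hQ
  rw [hT] at hl
  let l' := (U x :: R ++ [V (e + a + c)]) ++ ((V (x + c) :: Q.reverse ++ [U (e + a)]) ++
    (U e :: T.reverse ++ [V (y + c)]) ++ V (e + c) :: D ++ [U y])
  suffices h : Cy G U V π ({π y + π a} ∪ S) l' by
    refine ⟨D₁ ++ ((V (x + c) :: Q.reverse ++ [U (e + a)]) ++
      (U e :: T.reverse ++ [V (y + c)]) ++ V (e + c) :: D ++ [U y]), ?_⟩
    rw [← List.append_assoc, ← hD₁, hRe]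
    exact ⟨h.nodup, h.edges, by simpa only [hU', hV', hR.row_reflect] using h.mem⟩
  have hmem := hN.mem
  have hnod := hN.nodup
  have hed := hN.edges
  have hpe := hR'.edges_arc (-x) (s + 1 + d)
  have hpe' := hR'.edges_arc (-x + -((s + 1) • c)) s
  rw [← hU', ← hV'] at hpe hpe'
  rw [hRe] at hpe
  rw [hQ] at hpe'
  rw [hRe, hQ] at hmem hnod
  refine hl.extend (N := (U x :: R ++ [V (e + a + c)]) ++ (U (e + a) :: Q ++ [V (x + c)])) hR ?_
    hnod (fun w => ?_) (by simpa using hS) ?_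
  · rw [List.perm_iff_count]
    intro w
    simp only [l', List.count_append, List.count_cons, List.count_reverse, List.count_nil]
    omega
  · rw [hmem, hR.row_reflect]
    simp [hx]
  · have hle := hl.edges
    simp only [List.cons_append, List.append_assoc, List.nil_append,
      pathEdges_cons_cons, cycleEdges_cons, pathEdges_cons_append_cons_cons] at hle hpe hpe'
    simp only [l']
    rw [← List.append_assoc, cycleEdges_append_comm]
    simp only [List.cons_append, List.append_assoc, List.nil_append, pathEdges_cons_cons,
      cycleEdges_cons, pathEdges_cons_append_cons_cons, pathEdges_cons_reverse_append]
    simp only [Set.insert_subset_iff, Set.union_subset_iff, SimpleGraph.mem_edgeSet] at hle hpe hpe' ⊢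
    have a1 := hR.adjU y
    have a2 := (hR.adjV (x + c)).symm
    have a3 := (hR.adjU e).symm
    have a4 := hR.adjV (y + c)
    rw [hb] at a2 a4
    rw [show x + c + (s + 1) • c = e + a + c by rw [he, hx]; abel] at a2
    rw [show y + c + (s + 1) • c = e + c by rw [he]; abel] at a4
    tauto

theorem Rose.fiber_run [Finite A] {t : ℕ} (hb : b = t • c) (ht : 0 < t)
    (hn : 2 * t + 1 ≤ addOrderOf c) (j : ℕ) :
    ∀ {U V : A → W} {a : A} {π : A →+ K} {S : Set K} {y : A} {D : List W},
      Rose G U V a b c π → Cy G U V π S (arc U V c y t ++ D) →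
      (∀ i, 0 < i → i ≤ j → π y + i • π a ∉ S ∧ i • π a ≠ 0) →
      ∃ l, Cy G U V π {r | r ∈ S ∨ ∃ i, 0 < i ∧ i ≤ j ∧ r = π y + i • π a} l := by
  induction j with
  | zero =>
    intro U V a π S y D hR hl h
    refine ⟨_, hl.nodup, hl.edges, fun x => ?_⟩
    rw [hl.mem]
    refine exists_congr fun r => and_congr_left fun _ => ⟨Or.inl, ?_⟩
    rintro (h | ⟨i, h1, h2, _⟩)
    · exact h
    · omega
  | succ j ih =>
    intro U V a π S y D hR hl h
    obtain ⟨D', hD'⟩ := hR.fiber_step hb ht hn hl (by simpa using (h 1 one_pos (by omega)).1)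
    have ey : (-π) (-(y + a)) = π y + π a := by simp [add_comm]
    have ea : (-π) (-a) = π a := by simp
    obtain ⟨l, hl⟩ := ih hR.reflect.neg_left hD' (by
      intro i h0 hi
      have h1 := h (i + 1) (by omega) (by omega)
      have h2 := h i h0 (by omega)
      rw [ey, ea]
      simp only [Set.mem_union, Set.mem_singleton_iff, add_eq_left, not_or]
      refine ⟨⟨h2.2, ?_⟩, h2.2⟩
      have := h1.1
      rwa [succ_nsmul', ← add_assoc] at this)
    refine ⟨l, hl.nodup, hl.edges, fun x => ?_⟩
    rw [hl.mem]
    simp only [hR.row_reflect, ey, ea]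
    refine exists_congr fun r => and_congr_left fun _ => ?_
    simp only [Set.mem_union, Set.mem_singleton_iff, Set.mem_ofPred_eq]
    constructor
    · rintro ((rfl | h) | ⟨i, h1, h2, rfl⟩)
      · exact Or.inr ⟨1, by omega, by omega, by simp⟩
      · exact Or.inl h
      · exact Or.inr ⟨i + 1, by omega, by omega, by rw [succ_nsmul', add_assoc]⟩
    · rintro (h | ⟨i, h1, h2, rfl⟩)
      · exact Or.inl (Or.inr h)
      · obtain ⟨i, rfl⟩ : ∃ i', i = i' + 1 := ⟨i - 1, by omega⟩
        rcases Nat.eq_zero_or_pos i with rfl | hi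
        · exact Or.inl (Or.inl (by simp))
        · exact Or.inr ⟨i, hi, by omega, by rw [succ_nsmul', add_assoc]⟩

theorem Rose.isHamiltonian_of_nsmul [Finite A] [Fintype W] [DecidableEq W]
    (hR : Rose G U V a b c π) {t : ℕ} (hb : b = t • c) (ht : 0 < t)
    (hn : 2 * t + 1 ≤ addOrderOf c) (hgen : ∀ r, ∃ i : ℕ, r = i • π a)
    (hUV : ∀ x, ∃ z, x = U z ∨ x = V z) : G.IsHamiltonian := by
  have hK : Finite K := Finite.of_surjective _ hR.surj
  obtain ⟨D, hD⟩ := exists_arc_prefix (U := U) (V := V) (c := c) 0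
    (show t ≤ addOrderOf c - 1 by omega)
  have h := hR.cy_singleton (Or.inl rfl) (hR.rowPath_arc 0) _ rfl
  rw [hD] at h
  have hk := addOrderOf_pos (π a)
  obtain ⟨l, hl⟩ := Rose.fiber_run hb ht hn (addOrderOf (π a) - 1) hR h (by
    intro i h0 hi
    have : i • π a ≠ 0 := fun e =>
      absurd (Nat.le_of_dvd h0 (addOrderOf_dvd_of_nsmul_eq_zero e)) (by omega)
    simpa using this)
  refine hl.isHamiltonian hR (fun r => ?_) hUV
  obtain ⟨i, rfl⟩ := hgen r
  rw [← mod_addOrderOf_nsmul]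
  have := Nat.mod_lt i hk
  rcases Nat.eq_zero_or_pos (i % addOrderOf (π a)) with h0 | h0
  · exact Or.inl (by simp [h0])
  · exact Or.inr ⟨_, h0, by omega, by simp⟩

theorem Rose.isHamiltonian_of_map_eq_zero [Finite A] [Fintype W] [DecidableEq W]
    (hR : Rose G U V a b c π) (hb : π b = 0) (hb2 : 2 • b ≠ 0) (hgen : ∀ r, ∃ i : ℕ, r = i • π a)
    (hUV : ∀ x, ∃ z, x = U z ∨ x = V z) : G.IsHamiltonian := by
  obtain ⟨t, ht, e⟩ := (hR.map_eq (z := 0) (w := b)).1 (by simp [hb])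
  rw [zero_add] at e
  have h0 : t ≠ 0 := by rintro rfl; simp [e] at hb2
  have h1 : 2 * t ≠ addOrderOf c := by
    intro h
    rw [e, smul_smul, h, addOrderOf_nsmul_eq_zero] at hb2
    exact hb2 rfl
  rcases Nat.lt_or_gt_of_ne h1 with h | h
  · exact hR.isHamiltonian_of_nsmul e (by omega) h hgen hUV
  · refine hR.neg_right.isHamiltonian_of_nsmul (t := addOrderOf c - t) ?_ (by omega) (by omega)
      hgen hUV
    rw [neg_eq_iff_add_eq_zero, e, ← add_smul, Nat.add_sub_cancel' ht.le,
      addOrderOf_nsmul_eq_zero]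

end Fiber

section Diagonal
variable {W A K : Type*} [AddCommGroup A] [AddCommGroup K]
  {G : SimpleGraph W} {U V : A → W} {a b c : A} {π : A →+ K} {S : Set K} {l : List W}

theorem pathEdges_append_of_mem {X Y : List W} {p q : W} (hX : p ∈ X.getLast?)
    (hY : q ∈ Y.head?) : pathEdges (X ++ Y) = insert s(p, q) (pathEdges X ∪ pathEdges Y) := by
  obtain ⟨X, rfl⟩ := List.mem_getLast?_eq_getLast hX |>.elim fun h e =>
    (⟨_, (List.dropLast_append_getLast h).symm.trans (by rw [← e])⟩ : ∃ X', X = X' ++ [p])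
  obtain ⟨Y, rfl⟩ : ∃ Y', Y = q :: Y' := ⟨_, List.eq_cons_of_mem_head? hY⟩
  rw [List.append_assoc]
  exact pathEdges_append_cons_cons X Y p q

theorem arc_head (x : A) (i : ℕ) : U x ∈ (arc U V c x i).head? := by
  obtain ⟨t, ht⟩ := arc_eq (U := U) (V := V) (c := c) x i
  simp [ht]

theorem arc_last (x : A) (i : ℕ) : V (x + (i + 1) • c) ∈ (arc U V c x i).getLast? := by
  obtain ⟨t, ht⟩ := arc_eq (U := U) (V := V) (c := c) x i
  rw [ht, List.getLast?_append]
  simp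

theorem RowPath.head {z y : A} {N : List W} (h : RowPath G U V c π z y N) : U z ∈ N.head? := by
  obtain ⟨t, rfl⟩ := h.form
  simp

theorem RowPath.last {z y : A} {N : List W} (h : RowPath G U V c π z y N) :
    V y ∈ N.getLast? := by
  obtain ⟨t, rfl⟩ := h.form
  rw [List.getLast?_append]
  simp

/-- Inserting a detour through two rows that lie on a line. -/
theorem Rose.line_insert [Finite A] (hR : Rose G U V a b c π) (hl : Cy G U V π S l) {z y : A}
    (hs : Spoke c z y) (he : s(U z, V y) ∈ cycleEdges l) (hab : π a = π b) (ha : π a ≠ 0)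
    (h₁ : π (z + a) ∉ S) (h₂ : π (z + a + a) ∉ S) :
    ∃ l' u v, Cy G U V π ({π (z + a), π (z + a + a)} ∪ S) l' ∧
      cycleEdges l \ {s(U z, V y)} ⊆ cycleEdges l' ∧
      AlmostFull (cycleEdges l') U V c π (π (z + a + a)) u v := by
  have hn := hR.two_le
  obtain ⟨i, hi, hy⟩ := (hR.map_eq (z := z + a) (w := y + b - c)).1
    (by rw [map_sub, map_add, map_add, hR.map_spoke hs, hR.map_c, hab, sub_zero])
  obtain ⟨P, Q, hPQ⟩ := exists_arc_split (U := U) (V := V) (c := c) (z + a)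
    (addOrderOf c - 1) i (by omega)
  rw [succ_nsmul, ← add_assoc, ← hy, sub_add_cancel] at hPQ
  have hw : Spoke c (y + b - c + a) (z + a + b) := by
    rcases hs with rfl | rfl
    · exact Or.inr (by abel)
    · exact Or.inl (by abel)
  obtain ⟨N, hN⟩ := hR.exists_rowPath hw
  have hX := hR.rowPath_arc (z + a)
  have hXh := hX.head
  have hXl := hX.last
  have hXe := hX.edges
  have e2 : π (y + b - c + a) = π (z + a + a) := by
    simp only [map_sub, map_add, hR.map_spoke hs, hR.map_c, hab, sub_zero]
  have hd : π (z + a) ≠ π (y + b - c + a) := by rw [e2]; simpa using ha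
  have hdis := hR.disjoint_rowPath hX hN hd
  rw [hPQ, ← List.singleton_append, ← List.append_assoc] at hXh hXl hXe
  have hXh' : U (z + a) ∈ (P ++ [U (y + b - c)]).head? := by
    cases P <;> simpa using hXh
  have hXl' : V (z + a) ∈ (V (y + b) :: Q).getLast? := by
    rw [List.getLast?_append] at hXl
    simpa [List.getLast?_cons] using hXl
  have hA : U (y + b - c) ∈ (P ++ [U (y + b - c)]).getLast? := by simp
  rw [pathEdges_append_of_mem hA (q := V (y + b)) (by simp)] at hXe
  obtain ⟨l', hp, h1, h2, h3⟩ := exists_insert (hR.ne _ _) he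
    ((P ++ [U (y + b - c)]) ++ N ++ (V (y + b) :: Q).reverse)
  have hpe : pathEdges (U z :: ((P ++ [U (y + b - c)]) ++ N ++ (V (y + b) :: Q).reverse) ++ [V y]) =
      {s(U z, U (z + a)), s(U (y + b - c), U (y + b - c + a)), s(V (z + a + b), V (z + a)),
        s(V (y + b), V y)} ∪
        (pathEdges (P ++ [U (y + b - c)]) ∪ pathEdges N ∪ pathEdges (V (y + b) :: Q)) := by
    have l1 : V (z + a + b) ∈ (P ++ [U (y + b - c)] ++ N).getLast? := by
      have := hN.last
      rw [List.getLast?_append]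
      simp only [Option.mem_def] at this
      simp [this]
    have l2 : V (z + a) ∈ (V (y + b) :: Q).reverse.head? := by
      rw [List.head?_reverse]; exact hXl'
    have l3 : U (z + a) ∈ ((P ++ [U (y + b - c)]) ++ N ++ (V (y + b) :: Q).reverse).head? := by
      simp only [Option.mem_def] at hXh'
      rw [List.append_assoc, List.head?_append, hXh']
      simp
    rw [pathEdges_append_of_mem (p := V (y + b)) (q := V y) (by
        rw [List.reverse_cons, ← List.append_assoc, ← List.cons_append, List.getLast?_append]
        simp) (by simp),
      ← List.singleton_append,
      pathEdges_append_of_mem (p := U z) (q := U (z + a)) (by simp) l3,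
      pathEdges_append_of_mem l1 l2,
      pathEdges_append_of_mem hA hN.head, pathEdges_reverse]
    ext e
    simp only [Set.mem_insert_iff, Set.mem_union, Set.mem_singleton_iff, Set.mem_empty_iff_false,
      pathEdges_singleton]
    tauto
  rw [hpe] at h1 h3
  have hperm : ((P ++ [U (y + b - c)]) ++ N ++ (V (y + b) :: Q).reverse).Perm
      (arc U V c (z + a) (addOrderOf c - 1) ++ N) := by
    classical
    rw [hPQ, List.perm_iff_count]
    intro w
    simp only [List.count_append, List.count_cons, List.count_reverse, List.count_nil]
    omega
  refine ⟨l', y + b - c + a, z + a + b, hl.extend hR hp (hperm.nodup_iff.2 ?_) (fun x => ?_) ?_ ?_, h2, ?_⟩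
  · rw [List.nodup_append]
    exact ⟨hX.nodup, hN.nodup, hdis⟩
  · rw [hperm.mem_iff, List.mem_append, hX.mem, hN.mem, e2]
    simp
  · rintro r (rfl | rfl) <;> assumption
  · rw [Set.insert_subset_iff, Set.union_subset_iff] at hXe
    refine h1.trans (Set.union_subset hl.edges (Set.union_subset ?_ (Set.union_subset
      (Set.union_subset hXe.2.1 hN.edges) hXe.2.2)))
    simp only [Set.insert_subset_iff, Set.singleton_subset_iff, SimpleGraph.mem_edgeSet]
    exact ⟨hR.adjU z, hR.adjU _, (hR.adjV _).symm, (hR.adjV _).symm⟩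
  · rw [← e2]
    exact hN.almostFull fun e he => h3 (Or.inr (Or.inl (Or.inr he)))

/-- Inserting a detour through one row. -/
theorem Rose.row_insert [Finite A] (hR : Rose G U V a a c π) (hl : Cy G U V π S l) {z y : A}
    (hs : Spoke c z y) (he : s(U z, V y) ∈ cycleEdges l) (h₁ : π (z + a) ∉ S) :
    ∃ l', Cy G U V π ({π (z + a)} ∪ S) l' := by
  obtain ⟨N, hN⟩ := hR.exists_rowPath (spoke_add hs a)
  obtain ⟨l', hp, h1, -, -⟩ := exists_insert (hR.ne _ _) he N
  refine ⟨l', hl.extend hR hp hN.nodup (fun x => by rw [hN.mem]; simp) (by simpa using h₁) ?_⟩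
  refine h1.trans (Set.union_subset hl.edges ?_)
  have hl := hN.last
  rw [pathEdges_append_of_mem (p := V (y + a)) (q := V y) (by
      obtain ⟨t, rfl⟩ := hN.form
      rw [← List.cons_append, List.getLast?_append]; simp) (by simp),
    ← List.singleton_append, pathEdges_append_of_mem (p := U z) (by simp) hN.head]
  simp only [pathEdges_singleton, Set.insert_subset_iff, Set.union_subset_iff,
    SimpleGraph.mem_edgeSet, Set.empty_subset, and_true, true_and]
  exact ⟨(hR.adjV _).symm, hR.adjU _, hN.edges⟩

/-- Inserting two detours that share a row. -/
theorem Rose.split_insert [Finite A] (hR : Rose G U V a b c π) (hl : Cy G U V π S l) {z : A}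
    (he : s(U z, V z) ∈ cycleEdges l) (he' : s(U (z + a + b), V (z + a + b)) ∈ cycleEdges l)
    (hab : π a = π b) (hne : a ≠ b) (h0 : a + b ≠ 0) (h₁ : π (z + a) ∉ S) :
    ∃ l', Cy G U V π ({π (z + a)} ∪ S) l' := by
  have hn := hR.two_le
  obtain ⟨i, hi, hy⟩ := (hR.map_eq (z := z + a) (w := z + b)).1 (by simp [hab])
  obtain ⟨i, rfl⟩ : ∃ j, i = j + 1 := ⟨i - 1, by
    rcases Nat.eq_zero_or_pos i with rfl | h
    · simp at hy; exact absurd hy.symm hne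
    · omega⟩
  obtain ⟨d, hd⟩ := Nat.exists_eq_add_of_lt hi
  have hX := hR.rowPath_arc (z + a)
  rw [show addOrderOf c - 1 = i + d + 1 by omega, arc_append, ← hy] at hX
  have hA := arc_head (U := U) (V := V) (c := c) (z + a) i
  have hA' := arc_last (U := U) (V := V) (c := c) (z + a) i
  have hB := arc_head (U := U) (V := V) (c := c) (z + b) d
  have hB' := arc_last (U := U) (V := V) (c := c) (z + b) d
  rw [← hy] at hA'
  have e : z + b + (d + 1) • c = z + a := by
    rw [hy, add_assoc, ← add_smul, show i + 1 + (d + 1) = addOrderOf c by omega,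
      addOrderOf_nsmul_eq_zero, add_zero]
  rw [e] at hB'
  have hAe := hR.edges_arc (z + a) i
  have hBe := hR.edges_arc (z + b) d
  generalize arc U V c (z + a) i = N₁ at *
  generalize arc U V c (z + b) d = N₂ at *
  obtain ⟨l₁, hp₁, h1, h2, -⟩ := exists_insert (hR.ne _ _) he N₁
  have hne' : s(U (z + a + b), V (z + a + b)) ≠ s(U z, V z) := by
    rw [Ne, Sym2.eq_iff]
    rintro (⟨e, -⟩ | ⟨e, -⟩)
    · have := hR.injU e
      rw [add_assoc, add_eq_left] at this
      exact h0 this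
    · exact hR.ne _ _ e
  obtain ⟨l₂, hp₂, h3, -, -⟩ := exists_insert (hR.ne _ _) (h2 ⟨he', hne'⟩) N₂
  have key : ∀ {x y : W} {N : List W} {p q : W}, p ∈ N.head? → q ∈ N.getLast? → G.Adj x p →
      G.Adj q y → pathEdges N ⊆ G.edgeSet → pathEdges (x :: N ++ [y]) ⊆ G.edgeSet := by
    intro x y N p q hp hq hxp hqy hN
    have hq' : q ∈ (x :: N).getLast? := by
      simp only [Option.mem_def] at hq
      simp [List.getLast?_cons, hq]
    rw [pathEdges_append_of_mem hq' (q := y) (by simp), ← List.singleton_append,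
      pathEdges_append_of_mem (p := x) (by simp) hp]
    simp only [pathEdges_singleton, Set.insert_subset_iff, Set.union_subset_iff,
      SimpleGraph.mem_edgeSet, Set.empty_subset, and_true, true_and]
    exact ⟨hqy, hxp, hN⟩
  refine ⟨l₂, hl.extend hR (N := N₁ ++ N₂) (hp₂.trans ?_) hX.nodup
    (fun x => by rw [hX.mem]; simp) (by simpa using h₁) ?_⟩
  · rw [← List.append_assoc]
    exact hp₁.append_right _
  · refine h3.trans (Set.union_subset (h1.trans (Set.union_subset hl.edges ?_)) ?_)
    · exact key hA hA' (hR.adjU z) (hR.adjV z).symm hAe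
    · refine key hB hB' ?_ (hR.adjV _) hBe
      simpa [add_right_comm] using (hR.adjU (z + b)).symm

end Diagonal

section Diagonal
variable {W A K : Type*} [AddCommGroup A] [AddCommGroup K]
  {G : SimpleGraph W} {U V : A → W} {a b c : A} {π : A →+ K} {S : Set K} {l : List W}

theorem nsmul_inj_of_lt {g : K} {i j : ℕ} (hi : i < addOrderOf g) (hj : j < addOrderOf g)
    (h : i • g = j • g) : i = j :=
  nsmul_injOn_Iio_addOrderOf hi hj h

theorem Rose.diagonal_run [Fintype A] (hR : Rose G U V a b c π) (hab : π a = π b) (j : ℕ)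
    (hj : 2 * j < addOrderOf (π a)) :
    ∃ l, Cy G U V π {r | ∃ i ≤ 2 * j, i • π a = r} l ∧
      miss (cycleEdges l) U V c π 0 ≤ min j 1 ∧
      miss (cycleEdges l) U V c π ((2 * j) • π a) ≤ min j 1 := by
  induction j with
  | zero =>
    obtain ⟨-, l, hl, hm⟩ := Grown.single (cell := fun i : ℕ => i • π a) (k := 1) hR (by omega)
    have hm := hm 0 rfl
    simp only [zero_smul] at hm
    refine ⟨l, ?_, by simpa using hm, by simpa using hm⟩
    simpa using hl
  | succ j ih =>
    obtain ⟨l, hl, h0, h1⟩ := ih (by omega)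
    obtain ⟨z₀, hz₀⟩ := hR.surj ((2 * j) • π a)
    obtain ⟨z, y, hz, hs, he⟩ := hR.exists_spoke (E := cycleEdges l) z₀ (by rw [hz₀]; omega)
    rw [hz₀] at hz
    have e1 : π (z + a) = (2 * j + 1) • π a := by rw [map_add, hz, succ_nsmul]
    have e2 : π (z + a + a) = (2 * (j + 1)) • π a := by
      rw [map_add, e1, ← succ_nsmul]; rfl
    have hS : ∀ n, 2 * j < n → n ≤ 2 * (j + 1) →
        n • π a ∉ {r | ∃ i ≤ 2 * j, i • π a = r} := by
      rintro n hn hn' ⟨i, hi, e⟩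
      have := nsmul_inj_of_lt (by omega) (by omega) e
      omega
    have hone : 1 < addOrderOf (π a) := by omega
    obtain ⟨l', u, v, hl', h2, h3⟩ := hR.line_insert hl hs he hab
      (fun h => by simp [h] at hone) (by rw [e1]; exact hS _ (by omega) (by omega))
      (by rw [e2]; exact hS _ (by omega) le_rfl)
    refine ⟨l', ?_, ?_, ?_⟩
    · convert hl' using 1
      ext r
      simp only [e1, e2, Set.mem_union, Set.mem_insert_iff, Set.mem_singleton_iff,
        Set.mem_ofPred_eq]
      constructor
      · rintro ⟨i, hi, rfl⟩
        rcases (by omega : i ≤ 2 * j ∨ i = 2 * j + 1 ∨ i = 2 * (j + 1)) with h | rfl | rfl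
        · exact Or.inr ⟨i, h, rfl⟩
        · exact Or.inl (Or.inl rfl)
        · exact Or.inl (Or.inr rfl)
      · rintro ((rfl | rfl) | ⟨i, hi, rfl⟩)
        · exact ⟨_, by omega, rfl⟩
        · exact ⟨_, le_rfl, rfl⟩
        · exact ⟨i, by omega, rfl⟩
    · rcases Nat.eq_zero_or_pos j with rfl | hj0
      · have := hR.miss_le_add_one (E := cycleEdges l) (E' := cycleEdges l') (r := 0) (z₀ := z)
          (y₀ := y) fun w w' _ _ hne hw => h2 ⟨hw, hne⟩
        omega
      · have := miss_mono (E := cycleEdges l) (E' := cycleEdges l') (U := U) (V := V) (c := c)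
          (π := π) (r := 0) fun w w' hw _ hE => h2 ⟨hE, fun e => ?_⟩
        · omega
        · rcases Sym2.eq_iff.1 e with ⟨e, -⟩ | ⟨e, -⟩
          · rw [hR.injU e, hz, ← zero_nsmul (π a)] at hw
            have := nsmul_inj_of_lt (by omega) (by omega) hw
            omega
          · exact hR.ne _ _ e
    · rw [e2] at h3
      exact (hR.miss_le_one h3).trans (by simp)

theorem Rose.exists_split_insert [Fintype A] (hR : Rose G U V a b c π) (hl : Cy G U V π S l)
    {z : A} (hm : missAt (cycleEdges l) U V c z + missAt (cycleEdges l) U V c (z + a + b) ≤ 1)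
    (hab : π a = π b) (hne : a ≠ b) (h0 : a + b ≠ 0) (h₁ : π (z + a) ∉ S) :
    ∃ l', Cy G U V π ({π (z + a)} ∪ S) l' := by
  by_cases h : s(U z, V z) ∈ cycleEdges l ∧ s(U (z + a + b), V (z + a + b)) ∈ cycleEdges l
  · exact hR.split_insert hl h.1 h.2 hab hne h0 h₁
  have h' : s(U z, V (z + c)) ∈ cycleEdges l ∧
      s(U (z + a + b), V (z + a + b + c)) ∈ cycleEdges l := by
    unfold missAt at hm
    split_ifs at hm <;> first | omega | tauto
  have hcy : ∀ (S : Set K) l, Cy G (fun z => U (-z)) (fun z => V (c - z)) (-π) S l ↔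
      Cy G U V π S l := by
    intro S l
    constructor <;> rintro ⟨h1, h2, h3⟩
    · exact ⟨h1, h2, by simpa only [hR.row_reflect] using h3⟩
    · exact ⟨h1, h2, by simpa only [hR.row_reflect] using h3⟩
  have e : ∀ x : A, c - -x = x + c := fun x => by abel
  have e' : -z + -a + -b = -(z + a + b) := by abel
  obtain ⟨l', hl'⟩ := hR.reflect.neg_left.neg_right.split_insert ((hcy _ _).2 hl) (z := -z)
    (by simpa only [neg_neg, e] using h'.1)
    (by simpa only [e', neg_neg, e] using h'.2) (by simpa using hab) (by simpa using hne)
    (fun h => h0 (by rw [← neg_eq_zero, ← h]; abel))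
    (by simpa [add_comm] using h₁)
  refine ⟨l', ?_⟩
  rw [hcy] at hl'
  simpa [add_comm] using hl'

theorem Rose.isHamiltonian_of_map_eq [Fintype A] [Fintype W] [DecidableEq W]
    (hR : Rose G U V a b c π) (hab : π a = π b)
    (hgen : ∀ r, ∃ i : ℕ, r = i • π a)
    (hUV : ∀ x, ∃ z, x = U z ∨ x = V z) : G.IsHamiltonian := by
  have hK : Finite K := Finite.of_surjective _ hR.surj
  have hpos : 0 < addOrderOf (π a) := addOrderOf_pos _
  have hgen' : ∀ r, ∃ i < addOrderOf (π a), i • π a = r := by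
    intro r
    obtain ⟨i, rfl⟩ := hgen r
    exact ⟨i % addOrderOf (π a), Nat.mod_lt _ hpos, mod_addOrderOf_nsmul _ _⟩
  rcases Nat.even_or_odd' (addOrderOf (π a)) with ⟨n, hn | hn⟩
  · obtain ⟨j, rfl⟩ : ∃ j, n = j + 1 := ⟨n - 1, by omega⟩
    obtain ⟨l, hl, h0, h1⟩ := hR.diagonal_run hab j (by omega)
    have last : ∀ z l', π z = (2 * j) • π a →
        Cy G U V π ({π (z + a)} ∪ {r | ∃ i ≤ 2 * j, i • π a = r}) l' → G.IsHamiltonian := by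
      intro z l' hz hl'
      refine hl'.isHamiltonian hR (fun r => ?_) hUV
      obtain ⟨i, hi, rfl⟩ := hgen' r
      rcases (by omega : i ≤ 2 * j ∨ i = 2 * j + 1) with h | rfl
      · exact Or.inr ⟨i, h, rfl⟩
      · exact Or.inl (by simp [hz, succ_nsmul])
    have hS : ∀ z, π z = (2 * j) • π a → π (z + a) ∉ {r | ∃ i ≤ 2 * j, i • π a = r} := by
      rintro z hz ⟨i, hi, e⟩
      rw [map_add, hz, ← succ_nsmul] at e
      have := nsmul_inj_of_lt (by omega) (by omega) e
      omega
    obtain ⟨z₀, hz₀⟩ := hR.surj ((2 * j) • π a)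
    by_cases hne : a = b ∨ a + b = 0
    · obtain ⟨z, y, hz, hs, he⟩ := hR.exists_spoke (E := cycleEdges l) z₀ (by rw [hz₀]; omega)
      rw [hz₀] at hz
      have hR' : Rose G U V a a c π := by
        rcases hne with h | h
        · rwa [← h] at hR
        · have := hR.neg_right
          rwa [neg_eq_of_add_eq_zero_left h] at this
      obtain ⟨l', hl'⟩ := hR'.row_insert hl hs he (hS z hz)
      exact last z l' hz hl'
    · rw [not_or] at hne
      have key : ∃ z, π z = (2 * j) • π a ∧
          missAt (cycleEdges l) U V c z + missAt (cycleEdges l) U V c (z + a + b) ≤ 1 := by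
        have m1 := missAt_add_le (E := cycleEdges l) hR z₀
        have m2 := missAt_add_le (E := cycleEdges l) hR (z₀ + a + b)
        have e : π (z₀ + a + b) = 0 := by
          rw [map_add, map_add, hz₀, ← hab, ← succ_nsmul, ← succ_nsmul,
            ← addOrderOf_nsmul_eq_zero (π a), hn]
          rfl
        rw [e] at m2
        rw [hz₀] at m1
        by_cases h : missAt (cycleEdges l) U V c z₀ +
            missAt (cycleEdges l) U V c (z₀ + a + b) ≤ 1
        · exact ⟨z₀, hz₀, h⟩
        · refine ⟨z₀ + c, by simp [hz₀, hR.map_c], ?_⟩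
          rw [add_right_comm z₀ c a, add_right_comm (z₀ + a) c b]
          omega
      obtain ⟨z, hz, hm⟩ := key
      obtain ⟨l', hl'⟩ := hR.exists_split_insert hl hm hab hne.1 hne.2 (hS z hz)
      exact last z l' hz hl'
  · obtain ⟨l, hl, -, -⟩ := hR.diagonal_run hab n (by omega)
    refine hl.isHamiltonian hR (fun r => ?_) hUV
    obtain ⟨i, hi, rfl⟩ := hgen' r
    exact ⟨i, by omega, rfl⟩

end Diagonal

section Corner
variable {W : Type*}

theorem pathEdges_infix (P Q R : List W) : pathEdges Q ⊆ pathEdges (P ++ Q ++ R) := by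
  have h1 : ∀ P Q : List W, pathEdges Q ⊆ pathEdges (P ++ Q) := by
    intro P Q
    cases Q with
    | nil => simp
    | cons x Q => rw [pathEdges_append]; exact Set.subset_union_right
  refine (h1 P Q).trans ?_
  rw [← pathEdges_reverse (P ++ Q), ← pathEdges_reverse (P ++ Q ++ R),
    List.reverse_append (as := P ++ Q)]
  exact h1 _ _

theorem mem_pathEdges_mid (P Q : List W) (x y : W) : s(x, y) ∈ pathEdges (P ++ x :: y :: Q) := by
  rw [pathEdges_append_cons_cons]
  exact Set.mem_insert _ _

theorem cycleEdges_of_head {l : List W} {x : W} (h : x ∈ l.head?) :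
    cycleEdges l = pathEdges (l ++ [x]) := by
  obtain ⟨t, rfl⟩ : ∃ t, l = x :: t := ⟨_, List.eq_cons_of_mem_head? h⟩
  exact cycleEdges_cons x t

/-- A vertex on a cycle has at most two neighbours on it. -/
theorem eq_or_eq_of_mem_cycleEdges {l : List W} (hl : l.Nodup) {x p q r : W} (hp : p ≠ x)
    (hpq : p ≠ q) (h₁ : s(x, p) ∈ cycleEdges l) (h₂ : s(x, q) ∈ cycleEdges l)
    (h₃ : s(x, r) ∈ cycleEdges l) : r = p ∨ r = q := by
  obtain ⟨t, hperm, hc⟩ := exists_perm_of_mem_cycleEdges hp (by rwa [Sym2.eq_swap])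
  rw [← hc, cycleEdges_cons_append] at h₂ h₃
  have hn := hperm.nodup_iff.2 hl
  have key : ∀ y, y ≠ p → s(x, y) ∈ insert s(p, x) (pathEdges (p :: t ++ [x])) →
      y ∈ (p :: t).getLast? := by
    intro y hy h
    rcases h with h | h
    · rw [Sym2.eq_iff] at h
      rcases h with ⟨h, -⟩ | ⟨-, h⟩
      · exact absurd h.symm hp
      · exact absurd h hy
    · obtain ⟨t', z, e⟩ : ∃ t' z, p :: t = t' ++ [z] :=
        ⟨_, _, (List.dropLast_append_getLast (List.cons_ne_nil p t)).symm⟩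
      rw [e] at h hn ⊢
      rw [List.append_assoc, List.singleton_append, pathEdges_append_cons_cons] at h
      simp only [List.nodup_append, List.mem_append, List.mem_singleton, forall_eq] at hn
      rcases h with h | h | h
      · rw [Sym2.eq_iff] at h
        rcases h with ⟨h, -⟩ | ⟨-, h⟩
        · exact absurd h.symm (hn.2.2 z (Or.inr rfl))
        · simp [h]
      · have := mem_of_mem_pathEdges h
        rw [List.mem_append, List.mem_singleton] at this
        exact absurd rfl (hn.2.2 x this)
      · simp at h
  by_cases hr : r = p
  · exact Or.inl hr
  · have e₁ := key _ hpq.symm h₂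
    have e₂ := key _ hr h₃
    rw [Option.mem_def] at e₁ e₂
    exact Or.inr (Option.some_injective _ (e₂.symm.trans e₁))

theorem exists_corner_aux {u₁ u₂ u₄ p₁ q₁ p₂ q₂ p₄ q₄ : W} {A B D : List W}
    (hl : (u₁ :: (A ++ u₂ :: (B ++ u₄ :: D))).Nodup)
    (d₁ : ∀ r, s(u₁, r) ∈ cycleEdges (u₁ :: (A ++ u₂ :: (B ++ u₄ :: D))) → r = p₁ ∨ r = q₁)
    (d₂ : ∀ r, s(u₂, r) ∈ cycleEdges (u₁ :: (A ++ u₂ :: (B ++ u₄ :: D))) → r = p₂ ∨ r = q₂)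
    (d₄ : ∀ r, s(u₄, r) ∈ cycleEdges (u₁ :: (A ++ u₂ :: (B ++ u₄ :: D))) → r = p₄ ∨ r = q₄)
    (h₁₂ : u₁ ≠ p₂ ∧ u₁ ≠ q₂) (h₂₄ : u₂ ≠ p₄ ∧ u₂ ≠ q₄) (h₁₄ : u₁ ≠ p₄ ∧ u₁ ≠ q₄) :
    ∃ x v₁ v₄, (x = p₂ ∨ x = q₂) ∧ (v₁ = p₁ ∧ v₄ = p₄ ∨ v₁ = q₁ ∧ v₄ = q₄) ∧
      ∀ N : List W, ∃ l', l'.Perm ((u₁ :: (A ++ u₂ :: (B ++ u₄ :: D))) ++ N) ∧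
        cycleEdges l' ⊆ cycleEdges (u₁ :: (A ++ u₂ :: (B ++ u₄ :: D))) ∪ {s(u₁, u₂), s(v₁, v₄)} ∪
          pathEdges (x :: N ++ [u₄]) := by
  rw [cycleEdges_cons] at *
  obtain ⟨A', x, hA⟩ : ∃ A' x, A = A' ++ [x] := by
    rcases List.eq_nil_or_concat' A with rfl | h
    · have := d₂ u₁ (by
        rw [Sym2.eq_swap]; simp)
      tauto
    · exact h
  obtain ⟨v₁, A'', hA''⟩ : ∃ v A'', A = v :: A'' := by
    cases A with
    | nil => simp at hA
    | cons v A'' => exact ⟨_, _, rfl⟩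
  obtain ⟨B', y, hB⟩ : ∃ B' y, B = B' ++ [y] := by
    rcases List.eq_nil_or_concat' B with rfl | h
    · have := d₄ u₂ (by
        rw [Sym2.eq_swap]
        simpa using mem_pathEdges_mid (u₁ :: A) (D ++ [u₁]) u₂ u₄)
      tauto
    · exact h
  obtain ⟨w, D', hD⟩ : ∃ w D', D = w :: D' := by
    cases D with
    | nil =>
      have := d₄ u₁ (by
        simpa using mem_pathEdges_mid (u₁ :: (A ++ u₂ :: B)) [] u₄ u₁)
      tauto
    | cons w D' => exact ⟨_, _, rfl⟩
  have hx := d₂ x (by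
    rw [Sym2.eq_swap, hA]
    simpa using mem_pathEdges_mid (u₁ :: A') (B ++ u₄ :: (D ++ [u₁])) x u₂)
  have hv₁ := d₁ v₁ (by rw [hA'']; simp)
  have hy := d₄ y (by
    rw [Sym2.eq_swap, hB]
    simpa using mem_pathEdges_mid (u₁ :: (A ++ u₂ :: B')) (D ++ [u₁]) y u₄)
  have hw := d₄ w (by
    rw [hD]
    simpa using mem_pathEdges_mid (u₁ :: (A ++ u₂ :: B)) (D' ++ [u₁]) u₄ w)
  have hyw : y ≠ w := by
    rintro rfl
    rw [hB, hD] at hl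
    simp [List.nodup_append, List.nodup_cons] at hl
  have eA : pathEdges A ⊆ pathEdges (u₁ :: (A ++ u₂ :: (B ++ u₄ :: D)) ++ [u₁]) := by
    simpa using pathEdges_infix [u₁] A (u₂ :: (B ++ u₄ :: (D ++ [u₁])))
  have eB : pathEdges (u₂ :: B) ⊆ pathEdges (u₁ :: (A ++ u₂ :: (B ++ u₄ :: D)) ++ [u₁]) := by
    simpa using pathEdges_infix (u₁ :: A) (u₂ :: B) (u₄ :: (D ++ [u₁]))
  have eB' : pathEdges (u₂ :: (B ++ [u₄])) ⊆
      pathEdges (u₁ :: (A ++ u₂ :: (B ++ u₄ :: D)) ++ [u₁]) := by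
    simpa using pathEdges_infix (u₁ :: A) (u₂ :: (B ++ [u₄])) (D ++ [u₁])
  have eD : pathEdges (u₄ :: (D ++ [u₁])) ⊆
      pathEdges (u₁ :: (A ++ u₂ :: (B ++ u₄ :: D)) ++ [u₁]) := by
    simpa using pathEdges_infix (u₁ :: (A ++ u₂ :: B)) (u₄ :: (D ++ [u₁])) []
  have eD' : pathEdges (D ++ [u₁]) ⊆
      pathEdges (u₁ :: (A ++ u₂ :: (B ++ u₄ :: D)) ++ [u₁]) := by
    simpa using pathEdges_infix (u₁ :: (A ++ u₂ :: (B ++ [u₄]))) (D ++ [u₁]) []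
  generalize pathEdges (u₁ :: (A ++ u₂ :: (B ++ u₄ :: D)) ++ [u₁]) = E at *
  by_cases hc : v₁ = p₁ ∧ y = p₄ ∨ v₁ = q₁ ∧ y = q₄
  · refine ⟨x, v₁, y, hx, hc, fun N => ⟨A ++ N ++ (u₄ :: D) ++ [u₁] ++ (u₂ :: B), ?_, ?_⟩⟩
    · classical
      rw [List.perm_iff_count]
      intro w
      simp only [List.count_append, List.count_cons, List.count_nil]
      omega
    · rw [cycleEdges_of_head (x := v₁) (by simp [hA''])]
      have e₁ := pathEdges_append A' (N ++ u₄ :: (D ++ u₁ :: u₂ :: (B' ++ [y, v₁]))) x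
      have e₂ := pathEdges_append (x :: N) (D ++ u₁ :: u₂ :: (B' ++ [y, v₁])) u₄
      have e₃ := pathEdges_append_cons_cons (u₄ :: D) (B' ++ [y, v₁]) u₁ u₂
      have e₄ := pathEdges_append_cons_cons (u₂ :: B') [] y v₁
      rw [hA] at eA ⊢
      rw [hB] at eB ⊢
      simp only [List.cons_append, List.append_assoc, List.nil_append, pathEdges_singleton,
        Set.union_empty] at *
      rw [e₁, e₂, e₃, e₄]
      clear d₁ d₂ d₄ hl hx hv₁ hy hw h₁₂ h₂₄ h₁₄ hyw hc e₁ e₂ e₃ e₄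
      intro e
      have := @eA e
      have := @eB e
      have := @eD e
      simp only [Set.mem_union, Set.mem_insert_iff, Set.mem_singleton_iff, Sym2.eq_swap (a := y)]
      tauto
  · refine ⟨x, v₁, w, hx, ?_, fun N => ⟨A ++ N ++ (u₂ :: (B ++ [u₄])).reverse ++ [u₁] ++ D.reverse, ?_, ?_⟩⟩
    · have : (v₁ = p₁ ∨ v₁ = q₁) := hv₁
      rcases hv₁ with rfl | rfl <;> rcases hy with rfl | rfl <;> rcases hw with rfl | rfl <;> simp_all
    · classical
      rw [List.perm_iff_count]
      intro w
      simp only [List.count_append, List.count_cons, List.count_nil, List.count_reverse]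
      omega
    · rw [cycleEdges_of_head (x := v₁) (by simp [hA''])]
      have e₁ := pathEdges_append A' (N ++ u₄ :: (B.reverse ++ u₂ :: u₁ :: (D'.reverse ++ [w, v₁]))) x
      have e₂ := pathEdges_append (x :: N) (B.reverse ++ u₂ :: u₁ :: (D'.reverse ++ [w, v₁])) u₄
      have e₃ := pathEdges_append_cons_cons (u₄ :: B.reverse) (D'.reverse ++ [w, v₁]) u₂ u₁
      have e₄ := pathEdges_append_cons_cons (u₁ :: D'.reverse) [] w v₁
      rw [hA] at eA ⊢
      rw [← pathEdges_reverse] at eB' eD'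
      rw [hD] at eD' ⊢
      simp only [List.cons_append, List.append_assoc, List.nil_append, pathEdges_singleton,
        Set.union_empty, List.reverse_cons, List.reverse_append, List.reverse_nil] at *
      rw [e₁, e₂, e₃, e₄]
      clear d₁ d₂ d₄ hl hx hv₁ hy hw h₁₂ h₂₄ h₁₄ hyw hc e₁ e₂ e₃ e₄
      intro e
      have := @eA e
      have := @eB' e
      have := @eD' e
      simp only [Set.mem_union, Set.mem_insert_iff, Set.mem_singleton_iff, Sym2.eq_swap (a := w),
        Sym2.eq_swap (a := u₂)]
      tauto

end Corner

section Corner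
variable {W : Type*}

/-- Replacing two edges of a cycle by two chords and a detour. -/
theorem exists_corner {l : List W} {u₁ u₂ u₄ p₁ q₁ p₂ q₂ p₄ q₄ : W} (hl : l.Nodup)
    (m₁ : s(u₁, p₁) ∈ cycleEdges l ∧ s(u₁, q₁) ∈ cycleEdges l)
    (m₂ : s(u₂, p₂) ∈ cycleEdges l ∧ s(u₂, q₂) ∈ cycleEdges l)
    (m₄ : s(u₄, p₄) ∈ cycleEdges l ∧ s(u₄, q₄) ∈ cycleEdges l)
    (n : p₁ ≠ q₁ ∧ p₂ ≠ q₂ ∧ p₄ ≠ q₄) (hu : u₁ ≠ u₂ ∧ u₁ ≠ u₄ ∧ u₂ ≠ u₄)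
    (hp : ∀ u ∈ [u₁, u₂, u₄], ∀ p ∈ [p₁, q₁, p₂, q₂, p₄, q₄], u ≠ p) :
    ∃ x v₁ v₄, (x = p₂ ∨ x = q₂) ∧ (v₁ = p₁ ∧ v₄ = p₄ ∨ v₁ = q₁ ∧ v₄ = q₄) ∧
      ∀ N : List W, ∃ l', l'.Perm (l ++ N) ∧
        cycleEdges l' ⊆ cycleEdges l ∪ {s(u₁, u₂), s(v₁, v₄)} ∪ pathEdges (x :: N ++ [u₄]) := by
  simp only [List.mem_cons, List.not_mem_nil, or_false, forall_eq_or_imp, forall_eq] at hp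
  have d₁ : ∀ r, s(u₁, r) ∈ cycleEdges l → r = p₁ ∨ r = q₁ := fun r =>
    eq_or_eq_of_mem_cycleEdges hl (by tauto) n.1 m₁.1 m₁.2
  have d₂ : ∀ r, s(u₂, r) ∈ cycleEdges l → r = p₂ ∨ r = q₂ := fun r =>
    eq_or_eq_of_mem_cycleEdges hl (by tauto) n.2.1 m₂.1 m₂.2
  have d₄ : ∀ r, s(u₄, r) ∈ cycleEdges l → r = p₄ ∨ r = q₄ := fun r =>
    eq_or_eq_of_mem_cycleEdges hl (by tauto) n.2.2 m₄.1 m₄.2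
  have hmem : u₂ ∈ l ∧ u₄ ∈ l := ⟨mem_of_mem_cycleEdges m₂.1, mem_of_mem_cycleEdges m₄.1⟩
  obtain ⟨A, B, D, hperm, hc⟩ : ∃ A B D, (u₁ :: (A ++ u₂ :: (B ++ u₄ :: D))).Perm l ∧
      cycleEdges (u₁ :: (A ++ u₂ :: (B ++ u₄ :: D))) = cycleEdges l := by
    obtain ⟨t, hperm, hc⟩ := exists_perm_of_mem_cycleEdges (by tauto) m₁.1
    rw [List.cons_append] at hperm hc
    generalize t ++ [p₁] = r at *
    rw [← hperm.mem_iff, ← hperm.mem_iff, List.mem_cons, List.mem_cons] at hmem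
    obtain ⟨P, Q, rfl⟩ := List.mem_iff_append.1 (hmem.1.resolve_left hu.1.symm)
    have := hmem.2.resolve_left hu.2.1.symm
    rw [List.mem_append, List.mem_cons] at this
    rcases this with h | h | h
    · obtain ⟨P₁, P₂, rfl⟩ := List.mem_iff_append.1 h
      refine ⟨Q.reverse, P₂.reverse, P₁.reverse, (List.Perm.trans ?_ hperm), ?_⟩
      · classical
        rw [List.perm_iff_count]
        intro w
        simp only [List.count_append, List.count_cons, List.count_reverse]
        omega
      · rw [← hc, ← cycleEdges_reverse, List.reverse_cons, cycleEdges_append_comm]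
        simp
    · exact absurd h.symm hu.2.2
    · obtain ⟨Q₁, Q₂, rfl⟩ := List.mem_iff_append.1 h
      exact ⟨P, Q₁, Q₂, hperm, hc⟩
  rw [← hc] at d₁ d₂ d₄
  obtain ⟨x, v₁, v₄, hx, hv, h⟩ := exists_corner_aux (hperm.nodup_iff.2 hl) d₁ d₂ d₄
    (by tauto) (by tauto) (by tauto)
  refine ⟨x, v₁, v₄, hx, hv, fun N => ?_⟩
  obtain ⟨l', hp', he⟩ := h N
  rw [hc] at he
  exact ⟨l', hp'.trans (hperm.append_right _), he⟩

variable {A K : Type*} [AddCommGroup A] [AddCommGroup K]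
  {G : SimpleGraph W} {U V : A → W} {a b c : A} {π : A →+ K} {S : Set K} {l : List W}

/-- Inserting the fourth corner of a square. -/
theorem Rose.corner_insert [Finite A] (hR : Rose G U V a b c π) (hl : Cy G U V π S l) {z : A}
    (h₁ : s(U z, V z) ∈ cycleEdges l ∧ s(U z, V (z + c)) ∈ cycleEdges l)
    (h₂ : s(U (z + a), V (z + a)) ∈ cycleEdges l ∧ s(U (z + a), V (z + a + c)) ∈ cycleEdges l)
    (h₄ : s(U (z + b), V (z + b)) ∈ cycleEdges l ∧ s(U (z + b), V (z + b + c)) ∈ cycleEdges l)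
    (ha : a ≠ 0) (hb : b ≠ 0) (hab : a ≠ b) (hS : π (z + a + b) ∉ S) :
    ∃ l', Cy G U V π ({π (z + a + b)} ∪ S) l' := by
  have hc : ∀ z, V z ≠ V (z + c) := fun z e => hR.ne_zero (by simpa using hR.injV e)
  obtain ⟨x, v₁, v₄, hx, hv, h⟩ := exists_corner hl.nodup h₁ h₂ h₄ ⟨hc _, hc _, hc _⟩
    ⟨fun e => ha (by simpa using hR.injU e), fun e => hb (by simpa using hR.injU e),
      fun e => hab (by simpa using hR.injU e)⟩ (by simp [hR.ne])
  obtain ⟨y, hy, rfl⟩ : ∃ y, Spoke c (z + a) y ∧ x = V y := by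
    rcases hx with rfl | rfl
    · exact ⟨_, Or.inl rfl, rfl⟩
    · exact ⟨_, Or.inr rfl, rfl⟩
  obtain ⟨N, hN⟩ := hR.exists_rowPath (spoke_add hy b)
  obtain ⟨l', hp, he⟩ := h N.reverse
  have hv' : G.Adj v₁ v₄ := by
    rcases hv with ⟨rfl, rfl⟩ | ⟨rfl, rfl⟩
    · exact hR.adjV z
    · rw [add_right_comm]; exact hR.adjV _
  refine ⟨l', hl.extend hR hp (List.nodup_reverse.2 hN.nodup)
    (fun x => by rw [List.mem_reverse, hN.mem]; simp) (by simpa using hS) ?_⟩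
  refine he.trans (Set.union_subset (Set.union_subset hl.edges ?_) ?_)
  · simp only [Set.insert_subset_iff, Set.singleton_subset_iff, SimpleGraph.mem_edgeSet]
    exact ⟨hR.adjU z, hv'⟩
  · have hNl : V (y + b) ∈ N.reverse.head? := by rw [List.head?_reverse]; exact hN.last
    have hNh : U (z + a + b) ∈ (V y :: N.reverse).getLast? := by
      have := hN.head
      rw [Option.mem_def] at this
      simp [List.getLast?_cons, List.getLast?_reverse, this]
    rw [pathEdges_append_of_mem hNh (q := U (z + b)) (by simp), ← List.singleton_append,
      pathEdges_append_of_mem (p := V y) (by simp) hNl, pathEdges_reverse]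
    simp only [pathEdges_singleton, Set.insert_subset_iff, Set.union_subset_iff,
      SimpleGraph.mem_edgeSet, Set.empty_subset, and_true, true_and]
    refine ⟨?_, hR.adjV y, hN.edges⟩
    rw [add_right_comm]
    exact (hR.adjU _).symm

end Corner

section Five
variable {W A K : Type*} [AddCommGroup A] [AddCommGroup K]
  {G : SimpleGraph W} {U V : A → W} {a b c : A} {π : A →+ K}

theorem AlmostFull.spokes {E : Set (Sym2 W)} {r : K} {z y w : A} (hR : Rose G U V a b c π)
    (h : AlmostFull E U V c π r z y) (hw : π w = r) (hz : w ≠ z) :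
    s(U w, V w) ∈ E ∧ s(U w, V (w + c)) ∈ E := by
  have key : ∀ w', s(U w, V w') ≠ s(U z, V y) := by
    intro w' e
    rcases Sym2.eq_iff.1 e with ⟨e, -⟩ | ⟨e, -⟩
    · exact hz (hR.injU e)
    · exact hR.ne _ _ e
  exact ⟨h _ _ hw (Or.inl rfl) (key _), h _ _ hw (Or.inr rfl) (key _)⟩

theorem Rose.isHamiltonian_of_five [Finite A] [Fintype W] [DecidableEq W]
    (hR : Rose G U V a b c π) (hab : π a = 2 • π b) (h5 : addOrderOf (π b) = 5)
    (hgen : ∀ r, ∃ i : ℕ, r = i • π b) (hz : ∃ z, π z = π b ∧ z ≠ b ∧ z + b ≠ a)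
    (hUV : ∀ x, ∃ z, x = U z ∨ x = V z) : G.IsHamiltonian := by
  have hgen' : ∀ r, ∃ i < 5, i • π b = r := by
    intro r
    obtain ⟨i, rfl⟩ := hgen r
    exact ⟨i % 5, Nat.mod_lt _ (by norm_num), by rw [← h5, mod_addOrderOf_nsmul]⟩
  have hne : ∀ i j : ℕ, i < 5 → j < 5 → i ≠ j → i • π b ≠ j • π b := fun i j hi hj hij e =>
    hij (nsmul_inj_of_lt (h5 ▸ hi) (h5 ▸ hj) e)
  obtain ⟨z, hz, hzb, hza⟩ := hz
  have hN := hR.rowPath_arc 0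
  obtain ⟨t, ht⟩ := hN.form
  have hl := hR.cy_singleton (Or.inl rfl) hN 0 (map_zero π)
  have e1 : π b = 1 • π b := (one_nsmul _).symm
  have e3 : π (a + b) = 3 • π b := by rw [map_add, hab, ← succ_nsmul]
  have e0 : (0 : K) = 0 • π b := (zero_nsmul _).symm
  obtain ⟨l, hl', -, f₂, f₃, f₁⟩ := hR.square_insert hl (z := 0) (y := 0) (Or.inl rfl)
    (by rw [ht, cycleEdges_cons_append]; exact Set.mem_insert _ _)
    (by rw [hab, e0]; exact hne _ _ (by norm_num) (by norm_num) (by norm_num))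
    (by rw [e1, e0]; exact hne _ _ (by norm_num) (by norm_num) (by norm_num))
    (by rw [hab]; nth_rewrite 2 [e1]; exact hne _ _ (by norm_num) (by norm_num) (by norm_num))
    (by
      rw [zero_add, hab, Set.mem_singleton_iff, e0]
      exact hne _ _ (by norm_num) (by norm_num) (by norm_num))
    (by
      rw [zero_add, e3, Set.mem_singleton_iff, e0]
      exact hne _ _ (by norm_num) (by norm_num) (by norm_num))
    (by
      rw [zero_add, e1, Set.mem_singleton_iff, e0]
      exact hne _ _ (by norm_num) (by norm_num) (by norm_num))
  simp only [zero_add] at f₁ f₂ f₃ hl'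
  have e4 : π (z + a + b) = 4 • π b := by
    rw [map_add, map_add, hz, hab, ← succ_nsmul', ← succ_nsmul]
  obtain ⟨l', hl'⟩ := hR.corner_insert hl' (z := z) (f₁.spokes hR hz hzb)
    (f₃.spokes hR (by rw [map_add, map_add, hz, add_comm])
      (by rw [add_comm a]; simpa using hzb))
    (f₂.spokes hR (by rw [map_add, hz, hab, two_nsmul]) hza)
    (fun h => by
      have : π a = 0 := by rw [h, map_zero]
      exact hne 2 0 (by norm_num) (by norm_num) (by norm_num) (by rw [← hab, this, zero_nsmul]))
    (fun h => by
      have : π b = 0 := by rw [h, map_zero]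
      exact hne 1 0 (by norm_num) (by norm_num) (by norm_num) (by simp [this]))
    (fun h => hne 1 2 (by norm_num) (by norm_num) (by norm_num) (by rw [← hab, h, one_nsmul]))
    (by
      rw [e4, e3, hab, e0, Set.mem_union, Set.mem_insert_iff, Set.mem_insert_iff,
        Set.mem_singleton_iff, Set.mem_singleton_iff]
      have hne4 : ∀ j < 4, 4 • π b ≠ j • π b := fun j hj =>
        hne 4 j (by norm_num) (by omega) (by omega)
      rintro ((h | h | h) | h)
      · exact hne4 2 (by norm_num) h
      · exact hne4 3 (by norm_num) h
      · exact hne4 1 (by norm_num) (h.trans e1)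
      · exact hne4 0 (by norm_num) h)
  refine hl'.isHamiltonian hR (fun r => ?_) hUV
  obtain ⟨i, hi, rfl⟩ := hgen' r
  simp only [e4, e3, hab, Set.mem_union, Set.mem_insert_iff, Set.mem_singleton_iff]
  interval_cases i <;> simp

theorem Rose.isHamiltonian_of_ten [Fintype W] [DecidableEq W] (hR : Rose G U V a b c π)
    (ha : a = 2 • b + c) (hc : c = 5 • b) (hb : 10 • b = 0) (h5 : addOrderOf (π b) = 5)
    (hgen : ∀ z : A, ∃ i : ℕ, z = i • b) (hUV : ∀ x, ∃ z, x = U z ∨ x = V z) :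
    G.IsHamiltonian := by
  obtain ⟨φ, hφ⟩ : ∃ φ : ZMod 10 →+ A, ∀ i : ℕ, φ i = i • b :=
    have hb' : zmultiplesHom A b (10 : ℕ) = 0 := by
      rw [zmultiplesHom_apply, natCast_zsmul, hb]
    ⟨ZMod.lift 10 ⟨zmultiplesHom A b, hb'⟩, fun i => by
      simpa using ZMod.lift_coe 10 ⟨zmultiplesHom A b, hb'⟩ (i : ℤ)⟩
  have hinj : Function.Injective φ := by
    rw [injective_iff_map_eq_zero]
    intro x hx
    obtain ⟨i, hi, rfl⟩ : ∃ i : ℕ, i < 10 ∧ (i : ZMod 10) = x :=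
      ⟨x.val, x.val_lt, by simp⟩
    rw [hφ] at hx
    have hd : 5 ∣ i := by
      rw [← h5, addOrderOf_dvd_iff_nsmul_eq_zero, ← map_nsmul, hx, map_zero]
    obtain ⟨j, rfl⟩ := hd
    have hj : j < 2 := by omega
    interval_cases j
    · rfl
    · exact absurd (hc.trans hx) hR.ne_zero
  have hsurj : Function.Surjective φ := fun z => by
    obtain ⟨i, rfl⟩ := hgen z
    exact ⟨i, hφ i⟩
  have hφ' : ∀ (i : ℕ) [i.AtLeastTwo], φ (OfNat.ofNat i) = i • b := fun i _ => hφ i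
  have hφ1 : φ 1 = b := by simpa using hφ 1
  have hφa : φ 7 = a := by rw [hφ', ha, hc, ← add_smul]
  have hφc : φ 5 = c := by rw [hφ', hc]
  have adj₁ : ∀ x y, y = x + 5 → G.Adj (U (φ x)) (V (φ y)) := by
    rintro x _ rfl
    rw [map_add, hφc]
    exact hR.adj₁ _
  have adj₁' : ∀ x y, x = y + 5 → G.Adj (V (φ x)) (U (φ y)) := fun x y h => (adj₁ y x h).symm
  have adjU : ∀ x y, y = x + 7 → G.Adj (U (φ x)) (U (φ y)) := by
    rintro x _ rfl
    rw [map_add, hφa]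
    exact hR.adjU _
  have adjV : ∀ x y, y = x + 1 → G.Adj (V (φ x)) (V (φ y)) := by
    rintro x _ rfl
    rw [map_add, hφ1]
    exact hR.adjV _
  have adjV' : ∀ x y, x = y + 1 → G.Adj (V (φ x)) (V (φ y)) := fun x y h => (adjV y x h).symm
  let F : ZMod 10 ⊕ ZMod 10 → W := Sum.elim (U ∘ φ) (V ∘ φ)
  have hF : Function.Injective F :=
    Function.Injective.sumElim (hR.injU.comp hinj) (hR.injV.comp hinj) fun _ _ => hR.ne _ _
  let L : List (ZMod 10 ⊕ ZMod 10) :=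
    [.inl 0, .inl 7, .inl 4, .inl 1, .inl 8, .inl 5, .inl 2, .inr 2, .inr 3, .inr 4, .inl 9,
      .inr 9, .inr 0, .inr 1, .inl 6, .inl 3, .inr 8, .inr 7, .inr 6, .inr 5]
  have hL : ∀ x, x ∈ L := by
    rintro (x | x) <;>
      simp only [L, List.mem_cons, List.not_mem_nil, Sum.inl.injEq, Sum.inr.injEq, reduceCtorEq,
        or_false, false_or] <;>
      revert x <;> decide
  refine isHamiltonian_of_list (l := L.map F) ((List.nodup_map_iff hF).2 (by decide)) (fun x => ?_)
    (by simp [L]) ?_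
  · obtain ⟨z, hz⟩ := hUV x
    obtain ⟨i, rfl⟩ := hsurj z
    rcases hz with rfl | rfl
    · exact List.mem_map.2 ⟨.inl i, hL _, rfl⟩
    · exact List.mem_map.2 ⟨.inr i, hL _, rfl⟩
  · simp only [L, F, List.map_cons, List.map_nil, Sum.elim_inl, Sum.elim_inr, Function.comp_apply,
      cycleEdges_cons, List.cons_append, List.nil_append, pathEdges_cons_cons, pathEdges_singleton,
      Set.insert_subset_iff, SimpleGraph.mem_edgeSet, Set.empty_subset, and_true]
    refine ⟨?_, ?_, ?_, ?_, ?_, ?_, ?_, ?_, ?_, ?_, ?_, ?_, ?_, ?_, ?_, ?_, ?_, ?_, ?_, ?_⟩ <;>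
      first
        | exact hR.adj₀ _
        | exact (hR.adj₀ _).symm
        | exact adj₁ _ _ (by decide)
        | exact adj₁' _ _ (by decide)
        | exact adjU _ _ (by decide)
        | exact adjV _ _ (by decide)
        | exact adjV' _ _ (by decide)

theorem Rose.isHamiltonian_of_addOrderOf_five [Finite A] [Fintype W] [DecidableEq W]
    (hR : Rose G U V a b c π) (hab : π a = 2 • π b) (h5 : addOrderOf (π b) = 5)
    (hgen : ∀ r, ∃ i : ℕ, r = i • π b) (hUV : ∀ x, ∃ z, x = U z ∨ x = V z) :
    G.IsHamiltonian := by
  by_cases h : a = 2 • b + c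
  swap
  · refine hR.isHamiltonian_of_five hab h5 hgen ⟨b + c, by simp [hR.map_c], ?_, fun e => h ?_⟩ hUV
    · simpa using hR.ne_zero
    · rw [← e]; abel
  by_cases h2 : 2 • c = 0
  swap
  · refine hR.isHamiltonian_of_five hab h5 hgen ⟨b + 2 • c, by simp [hR.map_c], ?_, fun e => ?_⟩ hUV
    · simpa using h2
    · rw [h] at e
      have : c = 0 := by
        have := sub_eq_zero.2 e
        rw [← this]; abel
      exact hR.ne_zero this
  have hker : ∀ z, π z = 0 → z = 0 ∨ z = c := by
    intro z hz
    obtain ⟨j, hj, e⟩ := (hR.map_eq (z := 0) (w := z)).1 (by simpa using hz)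
    have := addOrderOf_le_of_nsmul_eq_zero (by norm_num) h2
    rw [zero_add] at e
    rcases (by omega : j = 0 ∨ j = 1) with rfl | rfl
    · exact Or.inl (by simpa using e)
    · exact Or.inr (by simpa using e)
  have hb5 : 5 • π b = 0 := by rw [← h5]; exact addOrderOf_nsmul_eq_zero _
  rcases hker (5 • b) (by rw [map_nsmul, hb5]) with hb | hb
  · have e : -π b = 4 • π b := by
      rw [neg_eq_iff_add_eq_zero, ← succ_nsmul', hb5]
    have ha5 : 3 • π a = π b := by
      rw [hab, smul_smul, ← one_nsmul (π b), smul_smul]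
      exact (nsmul_eq_nsmul_iff_modEq).2 (by rw [h5]; rfl)
    refine hR.dual.neg_left.isHamiltonian_of_five (by rw [map_neg, e, hab, smul_smul]; rfl) ?_
      (fun r => ?_) ⟨a + -c, by simp [hR.map_c], ?_, fun e => hR.ne_zero ?_⟩ (fun x => ?_)
    · rw [hab, addOrderOf_nsmul' _ (by norm_num), h5]
      norm_num
    · obtain ⟨i, rfl⟩ := hgen r
      exact ⟨i * 3, by rw [mul_smul, ha5]⟩
    · simpa using hR.ne_zero
    · have e' : 5 • b + c = a + -c + a - -b := by rw [h]; abel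
      rwa [hb, zero_add, e, sub_self] at e'
    · obtain ⟨z, hz⟩ := hUV x
      exact ⟨z, hz.symm⟩
  · refine hR.isHamiltonian_of_ten h hb.symm ?_ h5 (fun z => ?_) hUV
    · rw [show 10 = 2 * 5 by rfl, mul_smul, hb, h2]
    · obtain ⟨i, hi⟩ := hgen (π z)
      rcases hker (z - i • b) (by rw [map_sub, hi, map_nsmul, sub_self]) with e | e
      · exact ⟨i, sub_eq_zero.1 e⟩
      · exact ⟨5 + i, by rw [add_smul, hb, ← e]; abel⟩

end Five

theorem exists_gcd_eq_mul (k y : ℕ) : ∃ v, (Nat.gcd k y : ZMod k) = v * y := by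
  refine ⟨(Nat.gcdB k y : ℤ), ?_⟩
  have := congrArg (Int.cast : ℤ → ZMod k) (Nat.gcd_eq_gcd_ab k y)
  push_cast at this
  rw [this]
  simp [mul_comm]

section Cyclic
variable {W A : Type*} [AddCommGroup A] [Fintype A] [Fintype W] [DecidableEq W]
  {G : SimpleGraph W} {U V : A → W} {a b c : A} {k : ℕ} [NeZero k] {π : A →+ ZMod k}

theorem injOn_of_surj {cell : ℕ → ZMod k} (h : ∀ r, ∃ i < k, cell i = r) :
    ∀ i < k, ∀ j < k, cell i = cell j → i = j := by
  have hs : Function.Surjective fun i : Fin k => cell i := fun r => by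
    obtain ⟨i, hi, e⟩ := h r
    exact ⟨⟨i, hi⟩, e⟩
  have hi := ((Fintype.bijective_iff_surjective_and_card _).2 ⟨hs, by simp⟩).injective
  intro i hi' j hj' e
  exact congrArg Fin.val (@hi ⟨i, hi'⟩ ⟨j, hj'⟩ e)

theorem Rose.isHamiltonian_of_generator (hR : Rose G U V a b c π)
    (hgen : ∀ r, ∃ i : ℕ, r = i • π b) (ha0 : π a ≠ 0) (hab : π a ≠ π b) (hab' : π a ≠ -π b)
    (hUV : ∀ x, ∃ z, x = U z ∨ x = V z) : G.IsHamiltonian := by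
  have hk : k • π b = 0 := by simp
  have hsurj : ∀ r, ∃ i < k, i • π b = r := by
    intro r
    obtain ⟨i, rfl⟩ := hgen r
    refine ⟨i % k, Nat.mod_lt _ (NeZero.pos k), ?_⟩
    conv_rhs => rw [← Nat.div_add_mod i k]
    rw [add_smul, mul_comm, mul_smul, hk, smul_zero, zero_add]
  have hinj := injOn_of_surj hsurj
  have key : ∀ (a : A) (t : ℕ), Rose G U V a b c π → 2 ≤ t → 2 * t ≤ k → t • π b = π a →
      G.IsHamiltonian := by
    intro a t hR h2 htk hta
    by_cases h5 : k = 5 ∧ t = 2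
    · obtain ⟨rfl, rfl⟩ := h5
      refine hR.isHamiltonian_of_addOrderOf_five hta.symm ?_ hgen hUV
      have : Fact (Nat.Prime 5) := ⟨by norm_num⟩
      refine addOrderOf_eq_prime hk fun h => ?_
      exact absurd (hinj 1 (by norm_num) 0 (by norm_num) (by simpa using h)) (by norm_num)
    · have F : Frame G U V a b c π (fun N => N • π b) k t :=
        { rose := hR
          inj := hinj
          up := fun N _ => by rw [add_smul, hta]
          right := fun P x _ _ _ => by rw [succ_nsmul]
          two_le := h2 }
      obtain ⟨f, hf⟩ := F.helix (fun N => succ_nsmul _ _) htk h5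
      exact hf.isHamiltonian hR (fun i hi => hi) hsurj hUV
  obtain ⟨t, ht, hta⟩ := hsurj (π a)
  have h0 : t ≠ 0 := by rintro rfl; simp at hta; exact ha0 hta.symm
  have h1 : t ≠ 1 := by rintro rfl; simp at hta; exact hab hta.symm
  have hneg : (k - t) • π b = -π a := by
    rw [eq_neg_iff_add_eq_zero, ← hta, ← add_smul, Nat.sub_add_cancel ht.le, hk]
  rcases Nat.lt_or_ge k (2 * t) with h | h
  · refine key (-a) (k - t) hR.neg_left ?_ (by omega) (by rw [hneg, map_neg])
    by_contra hlt
    rw [show k - t = 1 by omega, one_nsmul] at hneg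
    exact hab' (by rw [hneg, neg_neg])
  · exact key a t hR (by omega) h hta

theorem Rose.isHamiltonian_of_grid (hR : Rose G U V a b c π) {s w : ℕ} (hk : k = s * w)
    (hgen : ∀ r, ∃ p q : ZMod k, r = p * π a + q * π b) (hs : ∃ v, (s : ZMod k) = v * π b)
    (hw : w • π b = 0) (hb0 : π b ≠ 0) (hodd : Odd s) (h3 : 3 ≤ s) (h5 : Odd w → 5 ≤ s)
    (hUV : ∀ x, ∃ z, x = U z ∨ x = V z) : G.IsHamiltonian := by
  have hkpos : 0 < k := NeZero.pos k
  have hwpos : 0 < w := Nat.pos_of_ne_zero fun h => by simp [h] at hk; omega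
  have hw2 : 2 ≤ w := by
    by_contra h
    rw [show w = 1 by omega, one_nsmul] at hw
    exact hb0 hw
  obtain ⟨v, hv⟩ := hs
  have hsurj : ∀ r, ∃ i < k, (fun N => (N / w) • π a + (N % w) • π b) i = r := by
    intro r
    obtain ⟨p, q, rfl⟩ := hgen r
    obtain ⟨p, rfl⟩ := ZMod.natCast_zmod_surjective p
    obtain ⟨q', hq'⟩ := ZMod.natCast_zmod_surjective (((p / s : ℕ) : ZMod k) * v * π a + q)
    have hlt : q' % w < w := Nat.mod_lt _ hwpos
    refine ⟨p % s * w + q' % w, ?_, ?_⟩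
    · have : p % s + 1 ≤ s := Nat.mod_lt _ (by omega)
      calc p % s * w + q' % w < (p % s + 1) * w := by rw [add_mul]; omega
        _ ≤ k := by rw [hk]; exact Nat.mul_le_mul_right _ this
    · have e1 : (p % s * w + q' % w) / w = p % s := by
        rw [mul_comm, Nat.mul_add_div hwpos, Nat.div_eq_of_lt hlt, add_zero]
      have e2 : (p % s * w + q' % w) % w = q' % w := by
        rw [mul_comm, Nat.mul_add_mod, Nat.mod_mod]
      have e3 : (q' % w) • π b = q' • π b := by
        conv_rhs => rw [← Nat.div_add_mod q' w, add_smul, mul_comm, mul_smul, hw, smul_zero,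
          zero_add]
      have e4 : (p : ZMod k) = s * (p / s : ℕ) + (p % s : ℕ) := by
        exact_mod_cast congrArg (Nat.cast : ℕ → ZMod k) (Nat.div_add_mod p s).symm
      simp only [e1, e2, e3]
      rw [nsmul_eq_mul, nsmul_eq_mul, hq', e4, hv]
      ring
  have F : Frame G U V a b c π (fun N => (N / w) • π a + (N % w) • π b) k w :=
    { rose := hR
      inj := injOn_of_surj hsurj
      up := fun N _ => by
        simp only [Nat.add_div_right _ hwpos, Nat.add_mod_right, succ_nsmul]
        abel
      right := by
        rintro _ x ⟨P, rfl⟩ hx -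
        simp only [add_assoc, Nat.mul_add_div hwpos, Nat.mul_add_mod, Nat.div_eq_of_lt hx,
          Nat.mod_eq_of_lt hx, Nat.div_eq_of_lt (Nat.lt_of_succ_lt hx),
          Nat.mod_eq_of_lt (Nat.lt_of_succ_lt hx), succ_nsmul]
      two_le := hw2 }
  obtain ⟨f, hf⟩ := F.grid hk hodd h3 h5
  exact hf.isHamiltonian hR (fun i hi => hi) hsurj hUV

theorem Rose.isHamiltonian_of_gcd (hR : Rose G U V a b c π) {x y : ℕ} (hx : π a = x)
    (hy : π b = y) (hgcd : Nat.gcd (Nat.gcd k x) (Nat.gcd k y) = 1) (ha2 : 2 • a ≠ 0)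
    (hb2 : 2 • b ≠ 0) (hUV : ∀ x, ∃ z, x = U z ∨ x = V z) : G.IsHamiltonian := by
  have hVU : ∀ x, ∃ z, x = V z ∨ x = U z := fun x => (hUV x).imp fun _ => Or.symm
  obtain ⟨u, hu⟩ := exists_gcd_eq_mul k x
  obtain ⟨v, hv⟩ := exists_gcd_eq_mul k y
  rw [← hx] at hu
  rw [← hy] at hv
  have hgen : ∀ r, ∃ p q : ZMod k, r = p * π a + q * π b := by
    intro r
    have := congrArg (Int.cast : ℤ → ZMod k) (Nat.gcd_eq_gcd_ab (Nat.gcd k x) (Nat.gcd k y))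
    rw [hgcd] at this
    push_cast at this
    rw [hu, hv] at this
    refine ⟨r * u * ((Nat.gcd k x).gcdA (Nat.gcd k y) : ℤ),
      r * v * ((Nat.gcd k x).gcdB (Nat.gcd k y) : ℤ), ?_⟩
    conv_lhs => rw [← mul_one r, this]
    ring
  have hmul : ∀ p z : ZMod k, ∃ i : ℕ, p * z = i • z := fun p z => by
    obtain ⟨i, rfl⟩ := ZMod.natCast_zmod_surjective p
    exact ⟨i, (nsmul_eq_mul _ _).symm⟩
  by_cases hb0 : π b = 0
  · refine hR.isHamiltonian_of_map_eq_zero hb0 hb2 (fun r => ?_) hUV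
    obtain ⟨p, q, rfl⟩ := hgen r
    rw [hb0, mul_zero, add_zero]
    exact hmul _ _
  by_cases ha0 : π a = 0
  · refine hR.dual.isHamiltonian_of_map_eq_zero ha0 ha2 (fun r => ?_) hVU
    obtain ⟨p, q, rfl⟩ := hgen r
    rw [ha0, mul_zero, zero_add]
    exact hmul _ _
  by_cases hab : π a = π b
  · refine hR.isHamiltonian_of_map_eq hab (fun r => ?_) hUV
    obtain ⟨p, q, rfl⟩ := hgen r
    rw [← hab, ← add_mul]
    exact hmul _ _
  by_cases hab' : π a = -π b
  · refine hR.neg_right.isHamiltonian_of_map_eq (by rw [hab', map_neg]) (fun r => ?_) hUV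
    obtain ⟨p, q, rfl⟩ := hgen r
    rw [← neg_neg (π b), ← hab', mul_neg, ← sub_eq_add_neg, ← sub_mul]
    exact hmul _ _
  have hgen1 : ∀ {z w : ZMod k}, ((1 : ℕ) : ZMod k) = w * z → ∀ r, ∃ i : ℕ, r = i • z := by
    intro z w h r
    obtain ⟨i, hi⟩ := hmul (r * w) z
    exact ⟨i, by rw [← hi, mul_assoc, ← h, Nat.cast_one, mul_one]⟩
  by_cases hb1 : Nat.gcd k y = 1
  · rw [hb1] at hv
    exact hR.isHamiltonian_of_generator (hgen1 hv) ha0 hab hab' hUV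
  by_cases ha1 : Nat.gcd k x = 1
  · rw [ha1] at hu
    exact hR.dual.isHamiltonian_of_generator (hgen1 hu) hb0 (Ne.symm hab)
      (fun h => hab' (by rw [h, neg_neg])) hVU
  have hkpos : 0 < k := NeZero.pos k
  have hpos : ∀ z, 0 < Nat.gcd k z := fun z => Nat.gcd_pos_of_pos_left _ hkpos
  have hw : ∀ z : ℕ, (k / Nat.gcd k z) • (z : ZMod k) = 0 := by
    intro z
    rw [nsmul_eq_mul, ← Nat.cast_mul, ZMod.natCast_eq_zero_iff]
    obtain ⟨e, he⟩ := Nat.gcd_dvd_right k z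
    refine ⟨e, ?_⟩
    calc k / k.gcd z * z = k / k.gcd z * (k.gcd z * e) := congrArg _ he
      _ = k * e := by rw [← mul_assoc, Nat.div_mul_cancel (Nat.gcd_dvd_left k z)]
  have hk : ∀ z, k = Nat.gcd k z * (k / Nat.gcd k z) := fun z =>
    (Nat.mul_div_cancel' (Nat.gcd_dvd_left k z)).symm
  have hgen' : ∀ r, ∃ p q : ZMod k, r = p * π b + q * π a := fun r => by
    obtain ⟨p, q, h⟩ := hgen r
    exact ⟨q, p, by rw [h, add_comm]⟩
  have caseB := hR.isHamiltonian_of_grid (hk y) hgen ⟨v, hv⟩ (by rw [hy]; exact hw y) hb0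
  have caseA := hR.dual.isHamiltonian_of_grid (hk x) hgen' ⟨u, hu⟩ (by rw [hx]; exact hw x) ha0
  have hpx := hpos x
  have hpy := hpos y
  have hkx := hk x
  have hky := hk y
  have hoddw : ∀ s w, k = s * w → Odd s → Odd w → Odd k := fun s w h h1 h2 => h ▸ h1.mul h2
  have hodd : Odd k → Odd (Nat.gcd k x) ∧ Odd (Nat.gcd k y) := fun h =>
    ⟨h.of_dvd_nat (Nat.gcd_dvd_left k x), h.of_dvd_nat (Nat.gcd_dvd_left k y)⟩
  have hor : Odd (Nat.gcd k x) ∨ Odd (Nat.gcd k y) := by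
    by_contra! h
    rw [Nat.not_odd_iff_even, Nat.not_odd_iff_even] at h
    have := Nat.dvd_gcd h.1.two_dvd h.2.two_dvd
    rw [hgcd] at this
    omega
  have hne : Nat.gcd k x ≠ Nat.gcd k y := by
    intro h
    rw [h, Nat.gcd_self] at hgcd
    exact hb1 hgcd
  by_cases ho : Odd k
  · obtain ⟨hox, hoy⟩ := hodd ho
    have : 5 ≤ Nat.gcd k x ∨ 5 ≤ Nat.gcd k y := by
      rw [Nat.odd_iff] at hox hoy
      omega
    rcases this with h | h
    · exact caseA hox (by omega) (fun _ => h) hVU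
    · exact caseB hoy (by omega) (fun _ => h) hUV
  · rcases hor with h | h
    · refine caseA h ?_ (fun h' => absurd (hoddw _ _ hkx h h') ho) hVU
      rw [Nat.odd_iff] at h
      omega
    · refine caseB h ?_ (fun h' => absurd (hoddw _ _ hky h h') ho) hUV
      rw [Nat.odd_iff] at h
      omega

end Cyclic

theorem castHom_eq_natCast_val {m n : ℕ} [NeZero m] (h : n ∣ m) (z : ZMod m) :
    ZMod.castHom h (ZMod n) z = z.val := by
  conv_lhs => rw [← ZMod.natCast_zmod_val z]
  exact map_natCast _ _

theorem castHom_gcd_eq_zero_iff {m : ℕ} [NeZero m] (c z : ZMod m) :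
    ZMod.castHom (Nat.gcd_dvd_left m c.val) (ZMod (Nat.gcd m c.val)) z = 0 ↔
      z ∈ AddSubgroup.zmultiples c := by
  have hval := castHom_eq_natCast_val (Nat.gcd_dvd_left m c.val)
  constructor
  · intro h
    rw [hval, ZMod.natCast_eq_zero_iff] at h
    obtain ⟨e, he⟩ := h
    obtain ⟨v, hv⟩ := exists_gcd_eq_mul m c.val
    obtain ⟨i, hi⟩ := ZMod.natCast_zmod_surjective (v * (e : ZMod m))
    refine AddSubgroup.mem_zmultiples_iff.2 ⟨i, ?_⟩
    rw [natCast_zsmul, nsmul_eq_mul, hi, ← ZMod.natCast_zmod_val z, he, Nat.cast_mul, hv,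
      ZMod.natCast_zmod_val]
    ring
  · intro h
    obtain ⟨i, rfl⟩ := AddSubgroup.mem_zmultiples_iff.1 h
    rw [map_zsmul, hval, (ZMod.natCast_eq_zero_iff _ _).2 (Nat.gcd_dvd_right m c.val), smul_zero]

theorem rose_roseWindow {m : ℕ} [NeZero m] {a b c : ZMod m} (ha : a ≠ 0) (hb : b ≠ 0)
    (hc : c ≠ 0) :
    Rose (roseWindow m a b c) Sum.inl Sum.inr a b c
      (ZMod.castHom (Nat.gcd_dvd_left m c.val) (ZMod (Nat.gcd m c.val))).toAddMonoidHom where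
  injU := Sum.inl_injective
  injV := Sum.inr_injective
  ne _ _ := Sum.inl_ne_inr
  adj₀ z := (SimpleGraph.fromRel_adj _ _ _).2 ⟨Sum.inl_ne_inr, Or.inl ⟨0, by simp⟩⟩
  adj₁ z := (SimpleGraph.fromRel_adj _ _ _).2 ⟨Sum.inl_ne_inr, Or.inl ⟨c, by simp⟩⟩
  adjU z := (SimpleGraph.fromRel_adj _ _ _).2 ⟨by simpa using ha, Or.inl ⟨a, by simp⟩⟩
  adjV z := (SimpleGraph.fromRel_adj _ _ _).2 ⟨by simpa using hb, Or.inl ⟨b, by simp⟩⟩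
  ker := castHom_gcd_eq_zero_iff c
  ne_zero := hc
  surj := ZMod.castHom_surjective (Nat.gcd_dvd_left m c.val)

/-- Every connected generalized rose window graph is hamiltonian. -/
theorem roseWindow_isHamiltonian (m : ℕ) [NeZero m] (hm : 3 ≤ m) (a b c : ZMod m)
    (ha : a ≠ 0) (hb : b ≠ 0) (hc : c ≠ 0)
    (ha2 : 2 * a ≠ 0) (hb2 : 2 * b ≠ 0)
    (hgcd : Nat.gcd m (Nat.gcd a.val (Nat.gcd b.val c.val)) = 1) :
    (roseWindow m a b c).IsHamiltonian := by
  have : NeZero (Nat.gcd m c.val) := ⟨(Nat.gcd_pos_of_pos_left _ (NeZero.pos m)).ne'⟩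
  have hval := castHom_eq_natCast_val (Nat.gcd_dvd_left m c.val)
  refine (rose_roseWindow ha hb hc).isHamiltonian_of_gcd (hval a) (hval b) ?_
    (by rwa [nsmul_eq_mul, Nat.cast_ofNat]) (by rwa [nsmul_eq_mul, Nat.cast_ofNat]) ?_
  · refine Nat.dvd_one.1 (hgcd ▸ ?_)
    have h1 := Nat.gcd_dvd_left ((m.gcd c.val).gcd a.val) ((m.gcd c.val).gcd b.val)
    have h2 := Nat.gcd_dvd_right ((m.gcd c.val).gcd a.val) ((m.gcd c.val).gcd b.val)
    have h3 := h1.trans (Nat.gcd_dvd_left _ _)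
    exact Nat.dvd_gcd (h3.trans (Nat.gcd_dvd_left _ _))
      (Nat.dvd_gcd (h1.trans (Nat.gcd_dvd_right _ _))
        (Nat.dvd_gcd (h2.trans (Nat.gcd_dvd_right _ _)) (h3.trans (Nat.gcd_dvd_right _ _))))
  · rintro (z | z)
    exacts [⟨z, Or.inl rfl⟩, ⟨z, Or.inr rfl⟩]
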